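/- arXiv:1809.00656 — 13 statements merged into one kernel-verified Lean document; each statement's English description precedes it below -/
import Mathlib

section
/- Let Γ be a finite L1 theory and φ an L1 sentence. If Γ ⊨ φ, then there is a proof tree of φ over Γ using only the rules (Axiom), (Barbara), and (Anti) in which every sentence occurring in the tree belongs to g(Γ ∪ {φ}). -/
inductive Tm1 (P R : Type) : Type
  | noun : P → Tm1 P R
  | allT : R → Tm1 P R → Tm1 P R

inductive Sent1 (P R : Type) : Type
  | allS : Tm1 P R → Tm1 P R → Sent1 P R

structure Model1 (P R : Type) where
  W : Type
  nounI : P → Set W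
  verbI : R → W → W → Prop

def Tm1.interp {P R : Type} (M : Model1 P R) : Tm1 P R → Set M.W
  | .noun p => M.nounI p
  | .allT r x => {m | ∀ n ∈ Tm1.interp M x, M.verbI r m n}

def Model1.sat {P R : Type} (M : Model1 P R) : Sent1 P R → Prop
  | .allS x y => Tm1.interp M x ⊆ Tm1.interp M y

def entails1 {P R : Type} (Γ : Set (Sent1 P R)) (φ : Sent1 P R) : Prop :=
  ∀ M : Model1 P R, (∀ ψ ∈ Γ, M.sat ψ) → M.sat φ

def Tm1.subterms {P R : Type} : Tm1 P R → Set (Tm1 P R)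
  | .noun p => {Tm1.noun p}
  | .allT r x => insert (Tm1.allT r x) (Tm1.subterms x)

def Tm1.verbs {P R : Type} : Tm1 P R → Set R
  | .noun _ => ∅
  | .allT r x => insert r (Tm1.verbs x)

def Sent1.subterms {P R : Type} : Sent1 P R → Set (Tm1 P R)
  | .allS x y => x.subterms ∪ y.subterms

def Sent1.verbs {P R : Type} : Sent1 P R → Set R
  | .allS x y => x.verbs ∪ y.verbs

/-- T(Δ): the set of subterms of sentences in Δ. -/
def Tset1 {P R : Type} (Δ : Set (Sent1 P R)) : Set (Tm1 P R) :=
  {t | ∃ φ ∈ Δ, t ∈ Sent1.subterms φ}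

/-- T⁺(Δ) = T(Δ) ∪ {(r all w) : w ∈ T(Δ), r a verb occurring in Δ}. -/
def Tplus1 {P R : Type} (Δ : Set (Sent1 P R)) : Set (Tm1 P R) :=
  Tset1 Δ ∪ {t | ∃ r : R, (∃ φ ∈ Δ, r ∈ Sent1.verbs φ) ∧ ∃ w ∈ Tset1 Δ, t = Tm1.allT r w}

/-- g(Δ): all sentences (all u v) with u ∈ T(Δ) and v ∈ T⁺(Δ). -/
def gSet1 {P R : Type} (Δ : Set (Sent1 P R)) : Set (Sent1 P R) :=
  {s | ∃ u ∈ Tset1 Δ, ∃ v ∈ Tplus1 Δ, s = Sent1.allS u v}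

/-- Γ ⊢_A φ via the rules (Axiom), (Barbara), (Anti): a proof tree over Γ with
root φ, all of whose sentences belong to A. -/
inductive PrIn1 {P R : Type} (A Γ : Set (Sent1 P R)) : Sent1 P R → Prop
  | hyp {φ} : φ ∈ Γ → φ ∈ A → PrIn1 A Γ φ
  | ax (x : Tm1 P R) : Sent1.allS x x ∈ A → PrIn1 A Γ (Sent1.allS x x)
  | barbara {x y z} : PrIn1 A Γ (Sent1.allS x y) → PrIn1 A Γ (Sent1.allS y z) →
      Sent1.allS x z ∈ A → PrIn1 A Γ (Sent1.allS x z)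
  | anti {x y} (r : R) : PrIn1 A Γ (Sent1.allS x y) →
      Sent1.allS (Tm1.allT r y) (Tm1.allT r x) ∈ A →
      PrIn1 A Γ (Sent1.allS (Tm1.allT r y) (Tm1.allT r x))

theorem Tm1.self_mem_subterms {P R : Type} (x : Tm1 P R) : x ∈ x.subterms := by
  cases x <;> simp [Tm1.subterms]

theorem Tm1.subterms_closed {P R : Type} {r : R} {x : Tm1 P R} (y : Tm1 P R)
    (h : Tm1.allT r x ∈ y.subterms) : x ∈ y.subterms ∧ r ∈ y.verbs := by
  induction y with
  | noun p => simp [Tm1.subterms] at h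
  | allT s z ih =>
    simp only [Tm1.subterms, Tm1.verbs, Set.mem_insert_iff] at h ⊢
    rcases h with h | h
    · cases h
      exact ⟨Or.inr (Tm1.self_mem_subterms _), Or.inl rfl⟩
    · exact ⟨Or.inr (ih h).1, Or.inr (ih h).2⟩

theorem Tset1_closed {P R : Type} {Δ : Set (Sent1 P R)} {r : R} {x : Tm1 P R}
    (h : Tm1.allT r x ∈ Tset1 Δ) : x ∈ Tset1 Δ ∧ ∃ φ ∈ Δ, r ∈ Sent1.verbs φ := by
  obtain ⟨⟨a, b⟩, hφ, h⟩ := h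
  rcases h with h | h
  · exact ⟨⟨_, hφ, Or.inl (Tm1.subterms_closed _ h).1⟩, _, hφ,
      Or.inl (Tm1.subterms_closed _ h).2⟩
  · exact ⟨⟨_, hφ, Or.inr (Tm1.subterms_closed _ h).1⟩, _, hφ,
      Or.inr (Tm1.subterms_closed _ h).2⟩

/-- The canonical model on the terms of T(Δ). -/
def canon1 {P R : Type} (Δ Γ : Set (Sent1 P R)) : Model1 P R where
  W := {t : Tm1 P R // t ∈ Tset1 Δ}
  nounI p := {t | PrIn1 (gSet1 Δ) Γ (.allS t.1 (.noun p))}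
  verbI r t u := PrIn1 (gSet1 Δ) Γ (.allS t.1 (.allT r u.1))

theorem canon1_truth {P R : Type} (Δ Γ : Set (Sent1 P R)) (x : Tm1 P R) (hx : x ∈ Tset1 Δ)
    (t : {t : Tm1 P R // t ∈ Tset1 Δ}) :
    t ∈ (Tm1.interp (canon1 Δ Γ) x : Set {t : Tm1 P R // t ∈ Tset1 Δ}) ↔
      PrIn1 (gSet1 Δ) Γ (.allS t.1 x) := by
  induction x generalizing t with
  | noun p => exact Iff.rfl
  | allT r x ih =>
    obtain ⟨hx', hr⟩ := Tset1_closed hx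
    constructor
    · intro h
      exact h ⟨x, hx'⟩ ((ih hx' ⟨x, hx'⟩).2 (.ax x ⟨x, hx', x, Or.inl hx', rfl⟩))
    · intro h u hu
      have hu' := (ih hx' u).1 hu
      have hp : Tm1.allT r u.1 ∈ Tplus1 Δ := Or.inr ⟨r, hr, u.1, u.2, rfl⟩
      exact .barbara h (.anti r hu' ⟨_, hx, _, hp, rfl⟩) ⟨_, t.2, _, hp, rfl⟩

/-- If Γ is a finite L1 theory with Γ ⊨ φ, then there is a proof tree of φ over Γ
using only (Axiom), (Barbara), (Anti), all of whose sentences lie in g(Γ ∪ {φ}). -/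
theorem stmt0 {P R : Type} (Γ : Set (Sent1 P R)) (φ : Sent1 P R)
    (hfin : Γ.Finite) (h : entails1 Γ φ) :
    PrIn1 (gSet1 (Γ ∪ {φ})) Γ φ := by
  have hT : ∀ x y, Sent1.allS x y ∈ Γ ∪ {φ} →
      x ∈ Tset1 (Γ ∪ {φ}) ∧ y ∈ Tset1 (Γ ∪ {φ}) := fun x y hxy =>
    ⟨⟨_, hxy, Or.inl x.self_mem_subterms⟩, ⟨_, hxy, Or.inr y.self_mem_subterms⟩⟩
  have hs := h (canon1 (Γ ∪ {φ}) Γ) (by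
    rintro ⟨x, y⟩ hxy t ht
    obtain ⟨hx, hy⟩ := hT x y (Or.inl hxy)
    have ht' := (canon1_truth _ Γ x hx t).1 ht
    exact (canon1_truth _ Γ y hy t).2
      (.barbara ht' (.hyp hxy ⟨_, hx, _, Or.inl hy, rfl⟩) ⟨_, t.2, _, Or.inl hy, rfl⟩))
  obtain ⟨x, y⟩ := φ
  obtain ⟨hx, hy⟩ := hT x y (Or.inr rfl)
  exact (canon1_truth _ Γ y hy ⟨x, hx⟩).1
    (hs ((canon1_truth _ Γ x hx ⟨x, hx⟩).2 (.ax x ⟨x, hx, x, Or.inl hx, rfl⟩)))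
end

section
/- If Γ ⊨ (all x y) in L2, then Γ ⊢₀ (all x y), and moreover the proof uses only the rules (Axiom), (Barbara), and (Anti). -/
inductive Tm (P R : Type) : Type
  | noun : P → Tm P R
  | allT : R → Tm P R → Tm P R

inductive Sent (P R : Type) : Type
  | allS : Tm P R → Tm P R → Sent P R
  | someS : Tm P R → Tm P R → Sent P R

structure Model (P R : Type) where
  W : Type
  nounI : P → Set W
  verbI : R → W → W → Prop

def Tm.interp {P R : Type} (M : Model P R) : Tm P R → Set M.W
  | .noun p => M.nounI p
  | .allT r x => {m | ∀ n ∈ Tm.interp M x, M.verbI r m n}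

def Model.sat {P R : Type} (M : Model P R) : Sent P R → Prop
  | .allS x y => Tm.interp M x ⊆ Tm.interp M y
  | .someS x y => (Tm.interp M x ∩ Tm.interp M y).Nonempty

def entails {P R : Type} (Γ : Set (Sent P R)) (φ : Sent P R) : Prop :=
  ∀ M : Model P R, (∀ ψ ∈ Γ, M.sat ψ) → M.sat φ

inductive Proves0 {P R : Type} (Γ : Set (Sent P R)) : Sent P R → Prop
  | hyp {φ} : φ ∈ Γ → Proves0 Γ φ
  | ax (x : Tm P R) : Proves0 Γ (Sent.allS x x)
  | barbara {x y z} : Proves0 Γ (Sent.allS x y) → Proves0 Γ (Sent.allS y z) →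
      Proves0 Γ (Sent.allS x z)
  | anti {x y} (r : R) : Proves0 Γ (Sent.allS x y) →
      Proves0 Γ (Sent.allS (Tm.allT r y) (Tm.allT r x))
  | some1 {x y} : Proves0 Γ (Sent.someS x y) → Proves0 Γ (Sent.someS x x)
  | some2 {x y} : Proves0 Γ (Sent.someS x y) → Proves0 Γ (Sent.someS y x)
  | darii {x y z} : Proves0 Γ (Sent.someS x y) → Proves0 Γ (Sent.allS y z) →
      Proves0 Γ (Sent.someS x z)

/-- Proofs using only the rules (Axiom), (Barbara), and (Anti) (plus hypotheses). -/
inductive ProvesAA {P R : Type} (Γ : Set (Sent P R)) : Sent P R → Prop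
  | hyp {φ} : φ ∈ Γ → ProvesAA Γ φ
  | ax (x : Tm P R) : ProvesAA Γ (Sent.allS x x)
  | barbara {x y z} : ProvesAA Γ (Sent.allS x y) → ProvesAA Γ (Sent.allS y z) →
      ProvesAA Γ (Sent.allS x z)
  | anti {x y} (r : R) : ProvesAA Γ (Sent.allS x y) →
      ProvesAA Γ (Sent.allS (Tm.allT r y) (Tm.allT r x))

/-- Canonical model whose points are pairs of terms. -/
def canon {P R : Type} (Γ : Set (Sent P R)) : Model P R where
  W := Tm P R × Tm P R
  nounI p := {m | ProvesAA Γ (Sent.allS m.1 (Tm.noun p)) ∨ ProvesAA Γ (Sent.allS m.2 (Tm.noun p))}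
  verbI r m n := ∃ t, (ProvesAA Γ (Sent.allS n.1 t) ∨ ProvesAA Γ (Sent.allS n.2 t)) ∧
    (ProvesAA Γ (Sent.allS m.1 (Tm.allT r t)) ∨ ProvesAA Γ (Sent.allS m.2 (Tm.allT r t)))

theorem canon_interp {P R : Type} (Γ : Set (Sent P R)) (t : Tm P R) (m : Tm P R × Tm P R) :
    m ∈ Tm.interp (canon Γ) t ↔
      (ProvesAA Γ (Sent.allS m.1 t) ∨ ProvesAA Γ (Sent.allS m.2 t)) := by
  induction t generalizing m with
  | noun p => exact Iff.rfl
  | allT r t ih =>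
    constructor
    · intro h
      obtain ⟨s, hs, hm⟩ := h (t, t) ((ih (t, t)).2 (Or.inl (ProvesAA.ax t)))
      have hts : ProvesAA Γ (Sent.allS t s) := hs.elim id id
      exact hm.imp (fun k => k.barbara (hts.anti r)) (fun k => k.barbara (hts.anti r))
    · intro h n hn
      exact ⟨t, (ih n).1 hn, h⟩

theorem ProvesAA.toProves0 {P R : Type} {Γ : Set (Sent P R)} {φ : Sent P R}
    (h : ProvesAA Γ φ) : Proves0 Γ φ := by
  induction h with
  | hyp h => exact .hyp h
  | ax x => exact .ax x
  | barbara _ _ h1 h2 => exact .barbara h1 h2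
  | anti r _ h => exact .anti r h

/-- If Γ ⊨ (all x y) in L2, then Γ ⊢₀ (all x y), and moreover the proof uses only
the rules (Axiom), (Barbara), and (Anti). -/
theorem stmt1 {P R : Type} (Γ : Set (Sent P R)) (x y : Tm P R)
    (h : entails Γ (Sent.allS x y)) :
    Proves0 Γ (Sent.allS x y) ∧ ProvesAA Γ (Sent.allS x y) := by
  have key : ProvesAA Γ (Sent.allS x y) := by
    have hM : (canon Γ).sat (Sent.allS x y) := by
      apply h
      intro ψ hψ
      cases ψ with
      | allS a b =>
        intro m hm
        have hab := ProvesAA.hyp hψ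
        exact (canon_interp Γ b m).2 (((canon_interp Γ a m).1 hm).imp
          (fun k => k.barbara hab) (fun k => k.barbara hab))
      | someS a b =>
        exact ⟨(a, b), (canon_interp Γ a (a, b)).2 (Or.inl (ProvesAA.ax a)),
          (canon_interp Γ b (a, b)).2 (Or.inr (ProvesAA.ax b))⟩
    have hx : (x, x) ∈ Tm.interp (canon Γ) y :=
      hM ((canon_interp Γ x (x, x)).2 (Or.inl (ProvesAA.ax x)))
    exact ((canon_interp Γ y (x, x)).1 hx).elim id id
  exact ⟨key.toProves0, key⟩
end

section
/- In the first canonical model M(Γ,T), for every term x ∈ T, the interpretation ⟦x⟧ equals the set of unordered pairs {t,u} in the domain such that t ≤ x or u ≤ x. -/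
def Tm.subterms {P R : Type} : Tm P R → Set (Tm P R)
  | .noun p => {Tm.noun p}
  | .allT r x => insert (Tm.allT r x) (Tm.subterms x)

/-- The first canonical model M(Γ,T): its domain is the set of unordered pairs {t,u}
of terms from T (singletons allowed). -/
def canonM {P R : Type} (Γ : Set (Sent P R)) (T : Set (Tm P R)) : Model P R where
  W := Sym2 {t : Tm P R // t ∈ T}
  nounI p := {s | ∃ a ∈ s, Proves0 Γ (Sent.allS a.1 (Tm.noun p))}
  verbI r s₁ s₂ := ∃ a ∈ s₁, ∃ b ∈ s₂, Proves0 Γ (Sent.allS a.1 (Tm.allT r b.1))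

/-- Truth Lemma for the first canonical model: for every term x ∈ T, the
interpretation of x is the set of unordered pairs {t,u} such that t ≤ x or u ≤ x
(where t ≤ x means Γ ⊢₀ (all t x)). -/
theorem stmt2 {P R : Type} (Γ : Set (Sent P R)) (T : Set (Tm P R))
    (hT : ∀ t ∈ T, Tm.subterms t ⊆ T) (x : Tm P R) (hx : x ∈ T) :
    Tm.interp (canonM Γ T) x =
      {s : Sym2 {t : Tm P R // t ∈ T} | ∃ a ∈ s, Proves0 Γ (Sent.allS a.1 x)} := by
  induction x with
  | noun p => rfl
  | allT r y ih =>
    have hself : y ∈ Tm.subterms y := by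
      cases y <;> simp [Tm.subterms]
    have hy : y ∈ T := hT _ hx (Set.mem_insert_of_mem _ hself)
    have ih' := ih hy
    ext s
    constructor
    · intro h
      have hm : (s(⟨y, hy⟩, ⟨y, hy⟩) : Sym2 {t : Tm P R // t ∈ T}) ∈
          Tm.interp (canonM Γ T) y := by
        rw [ih']
        exact ⟨⟨y, hy⟩, Sym2.mem_mk_left _ _, Proves0.ax y⟩
      obtain ⟨a, ha, b, hb, hab⟩ := h _ hm
      have hb' : b = ⟨y, hy⟩ := by
        rcases Sym2.mem_iff.mp hb with h | h <;> exact h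
      subst hb'
      exact ⟨a, ha, hab⟩
    · rintro ⟨a, ha, hay⟩ n hn
      rw [ih'] at hn
      obtain ⟨b, hb, hby⟩ := hn
      exact ⟨a, ha, b, hb, Proves0.barbara hay (Proves0.anti r hby)⟩
end

section
/- For any L2 theory Γ and terms x, y: Γ ⊢₀ (all x y) if and only if there is a Γ-sequence of terms t₁, …, tₙ with x = t₁ and y = tₙ. -/
/-- (r⃗ all x): iterated universal term former along a list of verbs. -/
def allVec {P R : Type} : List R → Tm P R → Tm P R
  | [], x => x
  | r :: rs, x => Tm.allT r (allVec rs x)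

/-- Anti(r⃗, (all u v)). -/
def antiSent {P R : Type} (rs : List R) (u v : Tm P R) : Sent P R :=
  if Even rs.length then Sent.allS (allVec rs u) (allVec rs v)
  else Sent.allS (allVec rs v) (allVec rs u)

/-- One step of a Γ-sequence: (all t t') = Anti(r⃗, ψ) for some ψ = (all u v) ∈ Γ. -/
def GammaStep {P R : Type} (Γ : Set (Sent P R)) (t t' : Tm P R) : Prop :=
  ∃ (u v : Tm P R) (rs : List R), Sent.allS u v ∈ Γ ∧ Sent.allS t t' = antiSent rs u v

theorem gammaStep_anti {P R : Type} {Γ : Set (Sent P R)} (r : R) {t t' : Tm P R}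
    (h : GammaStep Γ t t') : GammaStep Γ (Tm.allT r t') (Tm.allT r t) := by
  obtain ⟨u, v, rs, hm, he⟩ := h
  refine ⟨u, v, r :: rs, hm, ?_⟩
  unfold antiSent at he ⊢
  by_cases hev : Even rs.length
  · simp_all [allVec, Nat.even_add_one]
  · simp_all [allVec, Nat.even_add_one]

theorem proves_antiSent {P R : Type} {Γ : Set (Sent P R)} {u v : Tm P R}
    (h : Sent.allS u v ∈ Γ) (rs : List R) : Proves0 Γ (antiSent rs u v) := by
  induction rs with
  | nil => simpa [antiSent, allVec] using Proves0.hyp h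
  | cons r rs ih =>
    unfold antiSent at ih ⊢
    by_cases hev : Even rs.length
    · simp only [hev, if_true] at ih
      simpa [allVec, Nat.even_add_one, hev] using Proves0.anti r ih
    · simp only [hev, if_false] at ih
      simpa [allVec, Nat.even_add_one, hev] using Proves0.anti r ih

theorem proves_reach {P R : Type} {Γ : Set (Sent P R)} {φ : Sent P R}
    (h : Proves0 Γ φ) : ∀ x y, φ = Sent.allS x y →
      Relation.ReflTransGen (GammaStep Γ) x y := by
  induction h with
  | hyp h =>
    rintro x y rfl
    exact Relation.ReflTransGen.single ⟨x, y, [], h, by simp [antiSent, allVec]⟩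
  | ax z =>
    intro x y h
    cases h
    exact Relation.ReflTransGen.refl
  | barbara _ _ ih1 ih2 =>
    intro x y h
    cases h
    exact (ih1 _ _ rfl).trans (ih2 _ _ rfl)
  | anti r _ ih =>
    intro x y h
    cases h
    have h := ih _ _ rfl
    clear ih
    rename_i hp
    clear hp
    induction h with
    | refl => exact Relation.ReflTransGen.refl
    | tail _ hs ih' => exact Relation.ReflTransGen.head (gammaStep_anti r hs) ih'
  | some1 => intro x y h; cases h
  | some2 => intro x y h; cases h
  | darii => intro x y h; cases h

theorem reach_list {P R : Type} {Γ : Set (Sent P R)} {x y : Tm P R}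
    (h : Relation.ReflTransGen (GammaStep Γ) x y) :
    ∃ ts : List (Tm P R), ts ≠ [] ∧ List.Chain' (GammaStep Γ) ts ∧
        ts.head? = some x ∧ ts.getLast? = some y := by
  induction h using Relation.ReflTransGen.head_induction_on with
  | refl => exact ⟨[y], by simp, List.isChain_singleton _, rfl, rfl⟩
  | head hs _ ih =>
    obtain ⟨ts, hne, hc, hh, hl⟩ := ih
    cases ts with
    | nil => exact absurd rfl hne
    | cons a l =>
      simp only [List.head?_cons, Option.some.injEq] at hh
      subst hh
      exact ⟨_ :: a :: l, by simp, List.IsChain.cons_cons hs hc, rfl, by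
        simpa [List.getLast?_cons_cons] using hl⟩

theorem list_proves {P R : Type} {Γ : Set (Sent P R)} (ts : List (Tm P R)) :
    ∀ x y, List.Chain' (GammaStep Γ) ts → ts.head? = some x → ts.getLast? = some y →
      Proves0 Γ (Sent.allS x y) := by
  induction ts with
  | nil => intro x y _ h; simp at h
  | cons a l ih =>
    intro x y hc hh hl
    simp only [List.head?_cons, Option.some.injEq] at hh
    subst hh
    cases l with
    | nil =>
      simp at hl
      subst hl
      exact Proves0.ax _
    | cons b l =>
      obtain ⟨hs, hc'⟩ := List.isChain_cons_cons.1 hc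
      rw [List.getLast?_cons_cons] at hl
      obtain ⟨u, v, rs, hm, he⟩ := hs
      exact Proves0.barbara (he ▸ proves_antiSent hm rs) (ih b y hc' rfl hl)

/-- Γ ⊢₀ (all x y) iff there is a Γ-sequence of terms from x to y. -/
theorem stmt5 {P R : Type} (Γ : Set (Sent P R)) (x y : Tm P R) :
    Proves0 Γ (Sent.allS x y) ↔
      ∃ ts : List (Tm P R), ts ≠ [] ∧ List.Chain' (GammaStep Γ) ts ∧
        ts.head? = some x ∧ ts.getLast? = some y := by
  exact ⟨fun h => reach_list (proves_reach h _ _ rfl),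
    fun ⟨ts, _, hc, hh, hl⟩ => list_proves ts x y hc hh hl⟩
end

section
/- For any L2 theory Γ and terms x, y: Γ ⊢₀ (some x y) if and only if there is a sentence (some t₁ t₂) ∈ Γ such that Γ ⊢₀ (all tᵢ x) and Γ ⊢₀ (all tⱼ y) for some i, j ∈ {1,2}. -/
/-- Γ ⊢₀ (some x y) iff there is a sentence (some t₁ t₂) ∈ Γ such that
Γ ⊢₀ (all tᵢ x) and Γ ⊢₀ (all tⱼ y) for some i, j ∈ {1,2}. -/
theorem stmt6 {P R : Type} (Γ : Set (Sent P R)) (x y : Tm P R) :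
    Proves0 Γ (Sent.someS x y) ↔
      ∃ t₁ t₂ : Tm P R, Sent.someS t₁ t₂ ∈ Γ ∧
        (Proves0 Γ (Sent.allS t₁ x) ∨ Proves0 Γ (Sent.allS t₂ x)) ∧
        (Proves0 Γ (Sent.allS t₁ y) ∨ Proves0 Γ (Sent.allS t₂ y)) := by
  constructor
  · intro h
    generalize hφ : Sent.someS x y = φ at h
    induction h generalizing x y with
    | hyp h =>
      subst hφ
      exact ⟨x, y, h, Or.inl (.ax x), Or.inr (.ax y)⟩
    | ax => cases hφ
    | barbara => cases hφ
    | anti => cases hφ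
    | some1 _ ih =>
      cases hφ
      obtain ⟨t₁, t₂, hm, h1, _⟩ := ih _ _ rfl
      exact ⟨t₁, t₂, hm, h1, h1⟩
    | some2 _ ih =>
      cases hφ
      obtain ⟨t₁, t₂, hm, h1, h2⟩ := ih _ _ rfl
      exact ⟨t₁, t₂, hm, h2, h1⟩
    | darii _ hz ih _ =>
      cases hφ
      obtain ⟨t₁, t₂, hm, h1, h2⟩ := ih _ _ rfl
      exact ⟨t₁, t₂, hm, h1, h2.imp (fun h => .barbara h hz) (fun h => .barbara h hz)⟩
  · have key : ∀ {s t : Tm P R}, Proves0 Γ (Sent.someS s t) → Proves0 Γ (Sent.allS s x) →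
        Proves0 Γ (Sent.allS t y) → Proves0 Γ (Sent.someS x y) :=
      fun h hx hy => .some2 (.darii (.some2 (.darii h hy)) hx)
    rintro ⟨t₁, t₂, hm, h1 | h1, h2 | h2⟩
    · exact key (.some1 (.hyp hm)) h1 h2
    · exact key (.hyp hm) h1 h2
    · exact key (.some2 (.hyp hm)) h1 h2
    · exact key (.some1 (.some2 (.hyp hm))) h1 h2
end

section
/- For every n ≥ 1, the theory Γₙ semantically entails (some a a), i.e., Γₙ ⊨ (some a a). -/
/-- The two nouns a and b. -/
inductive N : Type
  | a | b

/-- The noun a as a term. -/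
def ta {n : ℕ} : Tm N (Fin n) := Tm.noun N.a

/-- The noun b as a term. -/
def tb {n : ℕ} : Tm N (Fin n) := Tm.noun N.b

/-- The theory Γₙ over nouns {a, b} and verbs {r₁, …, rₙ} (here rᵢ is index i-1 in `Fin n`):
α = (some (r₁ all (r₁ all a)) (r₁ all (r₁ all a))),
φᵢ = (all (rᵢ all b) (rᵢ₊₁ all (rᵢ₊₁ all a))) for 1 ≤ i ≤ n−1,
ω = (all (rₙ all b) a). -/
def GammaN (n : ℕ) (h : 0 < n) : Set (Sent N (Fin n)) :=
  {Sent.someS (Tm.allT ⟨0, h⟩ (Tm.allT ⟨0, h⟩ ta)) (Tm.allT ⟨0, h⟩ (Tm.allT ⟨0, h⟩ ta))} ∪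
  {s | ∃ i j : Fin n, i.1 + 1 = j.1 ∧
        s = Sent.allS (Tm.allT i tb) (Tm.allT j (Tm.allT j ta))} ∪
  {Sent.allS (Tm.allT ⟨n - 1, by omega⟩ tb) ta}

/-- For every n ≥ 1, Γₙ ⊨ (some a a). -/
theorem stmt7 (n : ℕ) (h : 0 < n) : entails (GammaN n h) (Sent.someS ta ta) := by
  intro M hM
  by_contra hne
  have hα := hM _ (Or.inl (Or.inl rfl))
  have hω := hM _ (Or.inr rfl)
  have hφ : ∀ i j : Fin n, i.1 + 1 = j.1 →
      M.sat (Sent.allS (Tm.allT i tb) (Tm.allT j (Tm.allT j ta))) :=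
    fun i j hij => hM _ (Or.inl (Or.inr ⟨i, j, hij, rfl⟩))
  have hemp : ∀ m, m ∉ Tm.interp M (ta : Tm N (Fin n)) := fun m hm => hne ⟨m, hm, hm⟩
  have key : ∀ (j : Fin n) (m : M.W),
      m ∈ Tm.interp M (Tm.allT j (Tm.allT j ta)) → ∀ w, M.verbI j m w :=
    fun j m hm w => hm w (fun k hk => absurd hk (hemp k))
  obtain ⟨m, hm, _⟩ := hα
  have all : ∀ (k : ℕ) (hk : k < n) (w : M.W), M.verbI ⟨k, hk⟩ m w := by
    intro k
    induction k with
    | zero => exact fun hk => key _ m hm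
    | succ k ih =>
      intro hk
      exact key _ m (hφ ⟨k, by omega⟩ ⟨k + 1, hk⟩ rfl (fun w _ => ih (by omega) w))
  exact hemp m (hω (fun w _ => all (n - 1) (by omega) w))
end

section
/- For any natural number k and any n ≥ k + 1, if Γₙ ⊨ₖ (some u v) for terms u, v, then u = v = (r₁ all (r₁ all a)), i.e., the sentence (some u v) equals α. -/
/-- The degree-k consequence relation Γ ⊨ₖ φ: there is a finite tree labeled with
sentences whose root is φ, such that every node is either a leaf labeled by a member
of Γ, or has children ψ₁,…,ψⱼ for some j ≤ k with {ψ₁,…,ψⱼ} ⊨ ψ. -/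
inductive EntailsDeg {P R : Type} (k : ℕ) (Γ : Set (Sent P R)) : Sent P R → Prop
  | hyp {φ} : φ ∈ Γ → EntailsDeg k Γ φ
  | step {φ} (l : List (Sent P R)) : l.length ≤ k →
      (∀ ψ ∈ l, EntailsDeg k Γ ψ) → entails {ψ | ψ ∈ l} φ → EntailsDeg k Γ φ

/-- Right-hand side of the o-th universal hypothesis. -/
noncomputable def rhsT {n : ℕ} (o : Fin n) : Tm N (Fin n) :=
  if h : o.1 + 1 < n then Tm.allT ⟨o.1 + 1, h⟩ (Tm.allT ⟨o.1 + 1, h⟩ ta) else ta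

/-- All-sentences derivable from exactly one hypothesis. -/
inductive Stp {n : ℕ} (o : Fin n) : Tm N (Fin n) → Tm N (Fin n) → Prop
  | base : Stp o (Tm.allT o tb) (rhsT o)
  | anti {x y} (r : Fin n) : Stp o x y → Stp o (Tm.allT r y) (Tm.allT r x)

def dep {n : ℕ} : Tm N (Fin n) → ℕ
  | .noun _ => 0
  | .allT _ x => dep x + 1

def leaf {n : ℕ} : Tm N (Fin n) → N
  | .noun p => p
  | .allT _ x => leaf x

theorem Stp.dep {n : ℕ} {o : Fin n} {x y} (h : Stp o x y) :
    _root_.dep x % 2 = 1 ∧ _root_.dep y % 2 = 0 := by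
  induction h with
  | base =>
    refine ⟨by simp [_root_.dep, tb], ?_⟩
    unfold rhsT
    split <;> simp [_root_.dep, ta]
  | anti r h ih => simp only [_root_.dep]; omega

theorem Stp.leaf {n : ℕ} {o : Fin n} {x y} (h : Stp o x y) :
    _root_.leaf x ≠ _root_.leaf y := by
  induction h with
  | base =>
    unfold rhsT
    split <;> simp [_root_.leaf, ta, tb]
  | anti r h ih => simpa only [_root_.leaf] using ih.symm

def LeT {n : ℕ} (x y : Tm N (Fin n)) : Prop := x = y ∨ ∃ o, Stp o x y

theorem LeT.trans {n : ℕ} {x y z : Tm N (Fin n)} (h : LeT x y) (h' : LeT y z) : LeT x z := by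
  rcases h with rfl | ⟨o, h⟩
  · exact h'
  · rcases h' with rfl | ⟨o', h'⟩
    · exact Or.inr ⟨o, h⟩
    · have := h.dep; have := h'.dep; omega

theorem LeT.anti {n : ℕ} {x y : Tm N (Fin n)} (r : Fin n) (h : LeT x y) :
    LeT (Tm.allT r y) (Tm.allT r x) := by
  rcases h with rfl | ⟨o, h⟩
  · exact Or.inl rfl
  · exact Or.inr ⟨o, h.anti r⟩

theorem LeT.even {n : ℕ} {x y : Tm N (Fin n)} (h : LeT x y) (hx : dep x % 2 = 0) : x = y := by
  rcases h with rfl | ⟨o, h⟩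
  · rfl
  · have := h.dep; omega

theorem LeT.leaf_eq {n : ℕ} {x y : Tm N (Fin n)} (h : LeT x y) (hx : leaf x = leaf y) : x = y := by
  rcases h with rfl | ⟨o, h⟩
  · rfl
  · exact absurd hx h.leaf

theorem stp_sat {n : ℕ} {o : Fin n} (M : Model N (Fin n))
    (hM : Tm.interp M (Tm.allT o tb) ⊆ Tm.interp M (rhsT o)) {x y} (h : Stp o x y) :
    Tm.interp M x ⊆ Tm.interp M y := by
  induction h with
  | base => exact hM
  | anti r h ih =>
    intro m hm k hk
    exact hm k (ih hk)

/-- The canonical model with the points in E removed. -/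
def canM {n : ℕ} (E : Tm N (Fin n) → Prop) : Model N (Fin n) where
  W := {t : Tm N (Fin n) // ¬ E t}
  nounI p := {s | LeT s.1 (Tm.noun p)}
  verbI r s t := LeT s.1 (Tm.allT r t.1)

theorem canM_allT {n : ℕ} (E : Tm N (Fin n) → Prop) (r : Fin n) (x : Tm N (Fin n)) (hx : ¬ E x)
    (ih : Tm.interp (canM E) x = {s | LeT s.1 x}) :
    Tm.interp (canM E) (Tm.allT r x) = {s | LeT s.1 (Tm.allT r x)} := by
  ext s
  change (∀ k ∈ Tm.interp (canM E) x, LeT s.1 (Tm.allT r k.1)) ↔ LeT s.1 (Tm.allT r x)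
  rw [ih]
  constructor
  · intro hs
    exact hs ⟨x, hx⟩ (Or.inl rfl)
  · intro hs k hk
    exact hs.trans (LeT.anti r hk)

theorem canM_noun {n : ℕ} (E : Tm N (Fin n) → Prop) (p : N) :
    Tm.interp (canM E) (Tm.noun p) = {s | LeT s.1 (Tm.noun p)} := rfl

/-- proper suffixes avoid E -/
def Good {n : ℕ} (E : Tm N (Fin n) → Prop) : Tm N (Fin n) → Prop
  | .noun _ => True
  | .allT _ x => ¬ E x ∧ Good E x

theorem canM_good {n : ℕ} (E : Tm N (Fin n) → Prop) (x : Tm N (Fin n)) (hx : Good E x) :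
    Tm.interp (canM E) x = {s | LeT s.1 x} := by
  induction x with
  | noun p => rfl
  | allT r x ih => exact canM_allT E r x hx.1 (ih hx.2)

theorem interp_top {n : ℕ} (M : Model N (Fin n)) (r : Fin n) (x : Tm N (Fin n))
    (hx : Tm.interp M x = ∅) (s : M.W) : s ∈ Tm.interp M (Tm.allT r x) := by
  intro k hk
  rw [hx] at hk
  exact hk.elim

/-- r (r a) in the model -/
theorem canM_rra {n : ℕ} (E : Tm N (Fin n) → Prop) (hE : ∀ x y, LeT x y → E y → E x)
    (ha : ¬ E ta) (j : Fin n) (s : (canM E).W)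
    (hs : LeT s.1 (Tm.allT j (Tm.allT j ta))) :
    s ∈ Tm.interp (canM E) (Tm.allT j (Tm.allT j ta)) := by
  by_cases h : E (Tm.allT j ta)
  · apply interp_top
    rw [canM_good E (Tm.allT j ta) ⟨ha, trivial⟩]
    ext t
    simp only [Set.mem_ofPred_eq, Set.mem_empty_iff_false, iff_false]
    intro ht
    exact t.2 (hE _ _ ht h)
  · rw [canM_good E (Tm.allT j (Tm.allT j ta)) ⟨h, ha, trivial⟩]
    exact hs

theorem canM_hyp {n : ℕ} (E : Tm N (Fin n) → Prop) (hE : ∀ x y, LeT x y → E y → E x)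
    (ha : ¬ E ta) (hb : ¬ E tb) (o : Fin n) :
    Tm.interp (canM E) (Tm.allT o tb) ⊆ Tm.interp (canM E) (rhsT o) := by
  rw [canM_good E (Tm.allT o tb) ⟨hb, trivial⟩]
  intro s hs
  have h2 : LeT s.1 (rhsT o) := LeT.trans hs (Or.inr ⟨o, Stp.base⟩)
  unfold rhsT at h2 ⊢
  split
  · rename_i h
    rw [dif_pos h] at h2
    exact canM_rra E hE ha _ s h2
  · rename_i h
    rw [dif_neg h] at h2
    exact h2

def al {n : ℕ} (h : 0 < n) : Tm N (Fin n) := Tm.allT ⟨0, h⟩ (Tm.allT ⟨0, h⟩ ta)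

/-- The invariant. -/
def SInv {n : ℕ} (h : 0 < n) : Sent N (Fin n) → Prop
  | .allS x y => LeT x y
  | .someS u v => u = al h ∧ v = al h

theorem inv_sat {n : ℕ} (h : 0 < n) (M : Model N (Fin n))
    (hM : ∀ o, Tm.interp M (Tm.allT o tb) ⊆ Tm.interp M (rhsT o))
    (hal : (Tm.interp M (al h)).Nonempty) (ψ) (hψ : SInv h ψ) : M.sat ψ := by
  cases ψ with
  | allS x y =>
    rcases hψ with rfl | ⟨o, hs⟩
    · exact subset_rfl
    · exact stp_sat M (hM o) hs
  | someS u v =>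
    obtain ⟨rfl, rfl⟩ := hψ
    simpa [Model.sat] using hal

theorem canM_sat {n : ℕ} (h : 0 < n) (E : Tm N (Fin n) → Prop)
    (hE : ∀ x y, LeT x y → E y → E x)
    (ha : ¬ E ta) (hb : ¬ E tb) (hal : ¬ E (al h)) (ψ) (hψ : SInv h ψ) : (canM E).sat ψ :=
  inv_sat h _ (canM_hyp E hE ha hb) ⟨⟨al h, hal⟩, canM_rra E hE ha _ _ (Or.inl rfl)⟩ ψ hψ

theorem good_of {n : ℕ} (u : Tm N (Fin n)) (x : Tm N (Fin n)) (hl : leaf x = leaf u)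
    (hd : dep x ≤ dep u) : Good (fun t => LeT t u) x := by
  induction x with
  | noun p => trivial
  | allT r x ih =>
    simp only [dep] at hd
    refine ⟨fun hx => ?_, ih hl (by omega)⟩
    have := hx.leaf_eq hl
    subst this
    omega

/-- one-point model: everything true except b -/
def mB (n : ℕ) : Model N (Fin n) where
  W := Unit
  nounI p := {_s | p = N.a}
  verbI _ _ _ := True

/-- one-point model missing o -/
def mA {n : ℕ} (o : Fin n) : Model N (Fin n) where
  W := Unit
  nounI p := {_s | p = N.b}
  verbI r _ _ := r.1 ≤ o.1

theorem mB_sat {n : ℕ} (h : 0 < n) (ψ) (hψ : SInv h ψ) : (mB n).sat ψ := by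
  refine inv_sat h _ ?_ ⟨(), fun _ _ => trivial⟩ ψ hψ
  intro o s _
  unfold rhsT
  split
  · exact fun _ _ => trivial
  · exact (rfl : N.a = N.a)

theorem mA_hyp {n : ℕ} (o o' : Fin n) (hne : o' ≠ o) :
    Tm.interp (mA o) (Tm.allT o' tb) ⊆ Tm.interp (mA o) (rhsT o') := by
  intro s hs
  have h1 : o'.1 ≤ o.1 := hs () (rfl : N.b = N.b)
  have h2 : o'.1 ≠ o.1 := fun e => hne (Fin.ext e)
  have h3 := o.2
  unfold rhsT
  rw [dif_pos (by omega)]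
  intro _ _
  change o'.1 + 1 ≤ o.1
  omega

theorem mA_sat {n : ℕ} (h : 0 < n) (o : Fin n) (ψ) (hψ : SInv h ψ)
    (ho : ∀ x y, ψ = Sent.allS x y → x = y ∨ ∃ o', o' ≠ o ∧ Stp o' x y) : (mA o).sat ψ := by
  cases ψ with
  | allS x y =>
    rcases ho x y rfl with rfl | ⟨o', hne, hs⟩
    · exact subset_rfl
    · exact stp_sat _ (mA_hyp o o' hne) hs
  | someS u v =>
    obtain ⟨rfl, rfl⟩ := hψ
    have : () ∈ Tm.interp (mA o) (al h) := fun _ _ => Nat.zero_le _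
    exact ⟨(), this, this⟩

theorem exists_missing {n k : ℕ} (hkn : k + 1 ≤ n) (l : List (Sent N (Fin n)))
    (hl : l.length ≤ k) (h : 0 < n) (hI : ∀ ψ ∈ l, SInv h ψ) :
    ∃ o : Fin n, ∀ ψ ∈ l, ∀ x y, ψ = Sent.allS x y → x = y ∨ ∃ o', o' ≠ o ∧ Stp o' x y := by
  classical
  have key : ∀ ψ : Sent N (Fin n), ∃ o : Fin n, ψ ∈ l →
      ∀ x y, ψ = Sent.allS x y → x = y ∨ Stp o x y := by
    intro ψ
    by_cases hψ : ψ ∈ l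
    · cases ψ with
      | allS x y =>
        rcases hI _ hψ with rfl | ⟨o, hs⟩
        · exact ⟨⟨0, h⟩, fun _ x' y' e => by cases e; exact Or.inl rfl⟩
        · exact ⟨o, fun _ x' y' e => by cases e; exact Or.inr hs⟩
      | someS u v => exact ⟨⟨0, h⟩, fun _ x' y' e => by cases e⟩
    · exact ⟨⟨0, h⟩, fun h' => absurd h' hψ⟩
  choose f hf using key
  have hc : (l.map f).toFinset.card < Fintype.card (Fin n) := by
    have := List.toFinset_card_le (l.map f)
    simp only [List.length_map] at this
    rw [Fintype.card_fin]
    omega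
  obtain ⟨o, ho⟩ : ∃ o, o ∉ (l.map f).toFinset := by
    by_contra hcon
    push Not at hcon
    have : (l.map f).toFinset = Finset.univ := Finset.eq_univ_iff_forall.2 hcon
    rw [this, Finset.card_univ] at hc
    exact lt_irrefl _ hc
  refine ⟨o, fun ψ hψ x y e => ?_⟩
  rcases hf ψ hψ x y e with h1 | h1
  · exact Or.inl h1
  · refine Or.inr ⟨f ψ, fun e' => ho ?_, h1⟩
    rw [List.mem_toFinset, ← e']
    exact List.mem_map_of_mem hψ

theorem some_step {n k : ℕ} (hkn : k + 1 ≤ n) (l : List (Sent N (Fin n)))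
    (hl : l.length ≤ k) (h : 0 < n) (hI : ∀ ψ ∈ l, SInv h ψ) (u : Tm N (Fin n))
    (hu : ∀ M : Model N (Fin n), (∀ ψ ∈ l, M.sat ψ) → (Tm.interp M u).Nonempty) : u = al h := by
  by_contra hne
  have hmain : u ≠ ta → u ≠ tb → False := by
    intro hua hub
    obtain ⟨s, hs⟩ := hu (canM (fun t => LeT t u)) (fun ψ hψ => canM_sat h _
      (fun x y hxy hy => hxy.trans hy) (fun hx => hua (hx.even rfl).symm)
      (fun hx => hub (hx.even rfl).symm) (fun hx => hne (hx.even (by simp [al, dep, ta])).symm) ψ (hI ψ hψ))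
    rw [canM_good _ u (good_of u u rfl le_rfl)] at hs
    exact s.2 hs
  cases u with
  | allT r t => exact hmain (by simp [ta]) (by simp [tb])
  | noun p =>
    cases p with
    | a =>
      obtain ⟨o, ho⟩ := exists_missing hkn l hl h hI
      obtain ⟨s, hs⟩ := hu (mA o) (fun ψ hψ => mA_sat h o ψ (hI ψ hψ) (ho ψ hψ))
      exact absurd (hs : N.a = N.b) (fun e => N.noConfusion e)
    | b =>
      obtain ⟨s, hs⟩ := hu (mB n) (fun ψ hψ => mB_sat h ψ (hI ψ hψ))
      exact absurd (hs : N.b = N.a) (fun e => N.noConfusion e)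

theorem inv_of_deg {n k : ℕ} (h : 0 < n) (hkn : k + 1 ≤ n) (φ : Sent N (Fin n))
    (hd : EntailsDeg k (GammaN n h) φ) : SInv h φ := by
  induction hd with
  | hyp hφ =>
    rcases hφ with (hφ | ⟨i, j, hij, hφ⟩) | hφ
    · cases hφ
      exact ⟨rfl, rfl⟩
    · subst hφ
      have hj : rhsT i = Tm.allT j (Tm.allT j ta) := by
        have hlt : i.1 + 1 < n := by have := j.2; omega
        have : j = ⟨i.1 + 1, hlt⟩ := Fin.ext hij.symm
        unfold rhsT
        rw [dif_pos hlt, this]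
      exact Or.inr ⟨i, hj ▸ Stp.base⟩
    · cases hφ
      refine Or.inr ⟨⟨n - 1, by omega⟩, ?_⟩
      have hj : rhsT (⟨n - 1, by omega⟩ : Fin n) = ta := by
        unfold rhsT
        rw [dif_neg (by simp only; omega)]
      have hb := Stp.base (o := (⟨n - 1, by omega⟩ : Fin n))
      rw [hj] at hb
      exact hb
  | @step φ l hl _ hent ih =>
    cases φ with
    | allS x y =>
      have hs := hent (canM (fun _ => False)) (fun ψ hψ => canM_sat h _
        (fun _ _ _ hf => hf) id id id ψ (ih ψ hψ))
      have hg : ∀ z : Tm N (Fin n), Good (fun _ => False) z := by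
        intro z
        induction z with
        | noun p => trivial
        | allT r z ihz => exact ⟨id, ihz⟩
      simp only [Model.sat] at hs
      rw [canM_good _ x (hg x), canM_good _ y (hg y)] at hs
      exact hs (a := ⟨x, id⟩) (Or.inl rfl)
    | someS u v =>
      exact ⟨some_step hkn l hl h ih u fun M hM => (hent M hM).mono Set.inter_subset_left,
        some_step hkn l hl h ih v fun M hM => (hent M hM).mono Set.inter_subset_right⟩

theorem stmt8 (k n : ℕ) (h : 0 < n) (hkn : k + 1 ≤ n) (u v : Tm N (Fin n))
    (hd : EntailsDeg k (GammaN n h) (Sent.someS u v)) :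
    u = Tm.allT ⟨0, h⟩ (Tm.allT ⟨0, h⟩ ta) ∧ v = Tm.allT ⟨0, h⟩ (Tm.allT ⟨0, h⟩ ta) :=
  inv_of_deg h hkn _ hd
end

section
/- For every natural number n, there exist a finite L2 theory Γ and an L2 sentence φ such that Γ ⊨ φ but Γ ⊭ₙ φ; specifically, Γₙ₊₁ ⊨ (some a a) and Γₙ₊₁ ⊭ₙ (some a a). -/
/-- One-point model in which all verbs up to index `k` are full and the others empty;
it satisfies every axiom except the `k`-th universal one. -/
def MM (n : ℕ) (k : Fin (n + 1)) : Model N (Fin (n + 1)) where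
  W := Unit
  nounI := fun p => match p with
    | N.a => ∅
    | N.b => Set.univ
  verbI := fun i _ _ => i ≤ k

/-- One-point model with empty verbs, `a` true. -/
def OO (n : ℕ) (β : Prop) : Model N (Fin (n + 1)) where
  W := Unit
  nounI := fun p => match p with
    | N.a => Set.univ
    | N.b => {_x | β}
  verbI := fun _ _ _ => False

/-- A two-point model of the whole theory. -/
def QQ (n : ℕ) : Model N (Fin (n + 1)) where
  W := Bool
  nounI := fun p => match p with
    | N.a => {false}
    | N.b => Set.univ
  verbI := fun i x y => (i = 0 ∧ x ≠ y) ∨ (i ≠ 0 ∧ y = false)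

/-- Nontrivial derivable inclusions. -/
inductive DD (n : ℕ) : Tm N (Fin (n + 1)) → Tm N (Fin (n + 1)) → Prop
  | base (i j : Fin (n + 1)) : i.1 + 1 = j.1 →
      DD n (Tm.allT i tb) (Tm.allT j (Tm.allT j ta))
  | last : DD n (Tm.allT (Fin.last n) tb) ta
  | anti {x y} (r : Fin (n + 1)) : DD n x y → DD n (Tm.allT r y) (Tm.allT r x)

def tlen {P R : Type} : Tm P R → ℕ
  | .noun _ => 0
  | .allT _ x => tlen x + 1

theorem DD_par {n : ℕ} {x y : Tm N (Fin (n + 1))} (h : DD n x y) :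
    tlen x % 2 = 1 ∧ tlen y % 2 = 0 := by
  induction h with
  | base i j h => simp [tlen, ta, tb]
  | last => simp [tlen, ta, tb]
  | anti r h ih => simp only [tlen]; omega

/-- The derivability preorder. -/
def LL (n : ℕ) (x y : Tm N (Fin (n + 1))) : Prop := x = y ∨ DD n x y

theorem LL_trans {n : ℕ} {x y z : Tm N (Fin (n + 1))} (h : LL n x y) (h' : LL n y z) :
    LL n x z := by
  rcases h with rfl | h
  · exact h'
  · rcases h' with rfl | h'
    · exact Or.inr h
    · have := DD_par h
      have := DD_par h'
      omega

theorem LL_anti {n : ℕ} {x y : Tm N (Fin (n + 1))} (r : Fin (n + 1)) (h : LL n x y) :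
    LL n (Tm.allT r y) (Tm.allT r x) := by
  rcases h with rfl | h
  · exact Or.inl rfl
  · exact Or.inr (DD.anti r h)

/-- The canonical model. -/
def CC (n : ℕ) : Model N (Fin (n + 1)) where
  W := Tm N (Fin (n + 1))
  nounI := fun p => {m | LL n m (Tm.noun p)}
  verbI := fun r m x => LL n m (Tm.allT r x)

theorem CC_interp {n : ℕ} (x : Tm N (Fin (n + 1))) :
    Tm.interp (CC n) x = {m : Tm N (Fin (n + 1)) | LL n m x} := by
  induction x with
  | noun p => rfl
  | allT r x ih =>
    ext m
    constructor
    · intro h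
      exact h x (by rw [ih]; exact Or.inl rfl)
    · intro h y hy
      rw [ih] at hy
      exact LL_trans h (LL_anti r hy)

theorem mem_Gamma {n : ℕ} {h : 0 < n + 1} {ψ : Sent N (Fin (n + 1))}
    (hψ : ψ ∈ GammaN (n + 1) h) :
    ψ = Sent.someS (Tm.allT 0 (Tm.allT 0 ta)) (Tm.allT 0 (Tm.allT 0 ta)) ∨
    (∃ i j : Fin (n + 1), i.1 + 1 = j.1 ∧
        ψ = Sent.allS (Tm.allT i tb) (Tm.allT j (Tm.allT j ta))) ∨
    ψ = Sent.allS (Tm.allT (Fin.last n) tb) ta := by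
  rcases hψ with (h1 | h1) | h1
  · exact Or.inl h1
  · exact Or.inr (Or.inl h1)
  · exact Or.inr (Or.inr h1)

theorem CC_sat {n : ℕ} {h : 0 < n + 1} : ∀ ψ ∈ GammaN (n + 1) h, (CC n).sat ψ := by
  intro ψ hψ
  rcases mem_Gamma hψ with rfl | ⟨i, j, hij, rfl⟩ | rfl
  · refine ⟨(Tm.allT 0 (Tm.allT 0 ta) : Tm N (Fin (n + 1))), ?_⟩
    rw [CC_interp]
    exact ⟨Or.inl rfl, Or.inl rfl⟩
  · simp only [Model.sat, CC_interp]
    intro m hm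
    exact LL_trans hm (Or.inr (DD.base i j hij))
  · simp only [Model.sat, CC_interp]
    intro m hm
    exact LL_trans hm (Or.inr DD.last)

theorem OO_sat {n : ℕ} {h : 0 < n + 1} (β : Prop) :
    ∀ ψ ∈ GammaN (n + 1) h, (OO n β).sat ψ := by
  intro ψ hψ
  rcases mem_Gamma hψ with rfl | ⟨i, j, hij, rfl⟩ | rfl
  · exact ⟨(), fun _ h => h () trivial, fun _ h => h () trivial⟩
  · intro m _
    exact fun _ h => h () trivial
  · intro m _
    trivial

theorem QQ_true {n : ℕ} (r : Fin (n + 1)) (x : Tm N (Fin (n + 1))) :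
    (true : Bool) ∈ (Tm.interp (QQ n) (Tm.allT r x) : Set Bool) ↔
      ¬ (true : Bool) ∈ (Tm.interp (QQ n) x : Set Bool) := by
  constructor
  · intro h hx
    rcases h _ hx with h | h
    · exact h.2 rfl
    · exact absurd h.2 (by decide)
  · intro h y hy
    have hy' : y = false := by
      cases y
      · rfl
      · exact absurd hy h
    subst hy'
    by_cases hr : r = 0
    · exact Or.inl ⟨hr, by decide⟩
    · exact Or.inr ⟨hr, rfl⟩

theorem QQ_b {n : ℕ} (r : Fin (n + 1)) (m : Bool) :
    ¬ m ∈ (Tm.interp (QQ n) (Tm.allT r tb) : Set Bool) := by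
  intro h
  have h1 := h m trivial
  have h2 := h true trivial
  rcases h1 with h1 | h1
  · exact h1.2 rfl
  · rcases h2 with h2 | h2
    · exact h1.1 h2.1
    · exact absurd h2.2 (by decide)

theorem QQ_sat {n : ℕ} {h : 0 < n + 1} : ∀ ψ ∈ GammaN (n + 1) h, (QQ n).sat ψ := by
  intro ψ hψ
  rcases mem_Gamma hψ with rfl | ⟨i, j, hij, rfl⟩ | rfl
  · have : (false : Bool) ∈
        (Tm.interp (QQ n) (Tm.allT 0 (Tm.allT 0 ta)) : Set Bool) := by
      intro y hy
      have := hy false rfl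
      rcases this with h | h
      · exact Or.inl ⟨rfl, fun h' => h.2 h'.symm⟩
      · exact absurd rfl h.1
    exact ⟨false, this, this⟩
  · intro m hm
    exact absurd hm (QQ_b i m)
  · intro m hm
    exact absurd hm (QQ_b _ m)

theorem MM_mem {n : ℕ} (k r : Fin (n + 1)) (hr : r ≤ k) (x : Tm N (Fin (n + 1))) (m : Unit) :
    m ∈ (Tm.interp (MM n k) (Tm.allT r x) : Set Unit) := fun _ _ => hr

theorem MM_b {n : ℕ} (k r : Fin (n + 1)) (m : Unit)
    (h : m ∈ (Tm.interp (MM n k) (Tm.allT r tb) : Set Unit)) : r ≤ k := h () trivial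

theorem sat_anti {P R : Type} (M : Model P R) (r : R) (x y : Tm P R)
    (h : M.sat (Sent.allS x y)) : M.sat (Sent.allS (Tm.allT r y) (Tm.allT r x)) :=
  fun _ hm z hz => hm z (h hz)

theorem MM_DD {n : ℕ} {x y : Tm N (Fin (n + 1))} (h : DD n x y) :
    ∃ k, ∀ k', k' ≠ k → (MM n k').sat (Sent.allS x y) := by
  induction h with
  | base i j h =>
    refine ⟨i, fun k hk m hm => ?_⟩
    have := MM_b _ _ _ hm
    apply MM_mem
    have h2 : k.1 ≠ i.1 := fun h => hk (Fin.ext h)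
    rw [Fin.le_def] at *
    omega
  | last =>
    refine ⟨Fin.last n, fun k hk m hm => ?_⟩
    have := MM_b _ _ _ hm
    exact absurd (le_antisymm (Fin.le_last k) this) hk
  | anti r h ih =>
    obtain ⟨k, hk⟩ := ih
    exact ⟨k, fun k' h' => sat_anti _ _ _ _ (hk k' h')⟩

theorem inv {n : ℕ} (x : Tm N (Fin (n + 1))) :
    ((() : Unit) ∈ (Tm.interp (OO n True) x : Set Unit) →
      (() : Unit) ∈ (Tm.interp (OO n False) x : Set Unit) →
      ¬ (true : Bool) ∈ (Tm.interp (QQ n) x : Set Bool)) ∧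
    (¬ (() : Unit) ∈ (Tm.interp (OO n True) x : Set Unit) →
      ¬ (() : Unit) ∈ (Tm.interp (OO n False) x : Set Unit) →
      (true : Bool) ∈ (Tm.interp (QQ n) x : Set Bool)) := by
  have key : ∀ (β : Prop) (r : Fin (n + 1)) (x : Tm N (Fin (n + 1))),
      (() : Unit) ∈ (Tm.interp (OO n β) (Tm.allT r x) : Set Unit) ↔
      ¬ (() : Unit) ∈ (Tm.interp (OO n β) x : Set Unit) := by
    intro β r x
    exact ⟨fun h hx => h () hx, fun h y hy => h hy⟩
  induction x with
  | noun p =>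
    cases p
    · refine ⟨fun _ _ h => ?_, fun h _ => absurd trivial h⟩
      exact absurd (show (true : Bool) = false from h) (by decide)
    · exact ⟨fun _ h => absurd h id, fun h => absurd trivial h⟩
  | allT r x ih =>
    rw [key, key, QQ_true]
    tauto

theorem head_zero {n : ℕ} {h : 0 < n + 1} {r : Fin (n + 1)} {x : Tm N (Fin (n + 1))}
    (he : ∀ M : Model N (Fin (n + 1)), (∀ ψ ∈ GammaN (n + 1) h, M.sat ψ) →
      (Tm.interp M (Tm.allT r x)).Nonempty) : r = 0 := by
  by_contra hr
  obtain ⟨u, h1⟩ := he _ (OO_sat True)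
  obtain ⟨v, h2⟩ := he _ (OO_sat False)
  obtain ⟨w, h3⟩ := he _ QQ_sat
  have hx := (inv x).2 (fun h => h1 _ h) (fun h => h2 _ h)
  rcases h3 _ hx with h | h
  · exact hr h.1
  · exact absurd h.2 (by decide)

/-- A set closed under degree-`n` consequence. -/
def SS (n : ℕ) (ψ : Sent N (Fin (n + 1))) : Prop :=
  entails (GammaN (n + 1) (Nat.succ_pos n)) ψ ∧
  (∃ k, ∀ k', k' ≠ k → (MM n k').sat ψ) ∧
  ∀ x y, ψ = Sent.someS x y → ∀ k, (MM n k).sat ψ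

theorem SS_all {n : ℕ} {x y : Tm N (Fin (n + 1))}
    (h : entails (GammaN (n + 1) (Nat.succ_pos n)) (Sent.allS x y)) : SS n (Sent.allS x y) := by
  refine ⟨h, ?_, fun _ _ h => by cases h⟩
  have h1 := h _ CC_sat
  simp only [Model.sat, CC_interp] at h1
  rcases h1 (show LL n x x from Or.inl rfl) with rfl | h1
  · exact ⟨0, fun _ _ => subset_rfl⟩
  · exact MM_DD h1

theorem MM_all {n : ℕ} {h : 0 < n + 1} (k k' : Fin (n + 1)) (x : Tm N (Fin (n + 1)))
    (hk : (Tm.interp (MM n k) x).Nonempty)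
    (he : ∀ M : Model N (Fin (n + 1)), (∀ ψ ∈ GammaN (n + 1) h, M.sat ψ) →
      (Tm.interp M x).Nonempty) : (() : Unit) ∈ (Tm.interp (MM n k') x : Set Unit) := by
  cases x with
  | noun p =>
    cases p
    · exact absurd hk.choose_spec id
    · trivial
  | allT r x =>
    have := head_zero he
    subst this
    exact MM_mem _ _ (Fin.zero_le _) _ _

theorem SS_some {n : ℕ} {x y : Tm N (Fin (n + 1))}
    (h : entails (GammaN (n + 1) (Nat.succ_pos n)) (Sent.someS x y)) (k : Fin (n + 1))
    (hk : (MM n k).sat (Sent.someS x y)) : SS n (Sent.someS x y) := by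
  have key : ∀ k', (MM n k').sat (Sent.someS x y) := fun k' =>
    ⟨(), MM_all k k' x (hk.mono Set.inter_subset_left)
        (fun M hM => (h M hM).mono Set.inter_subset_left),
      MM_all k k' y (hk.mono Set.inter_subset_right)
        (fun M hM => (h M hM).mono Set.inter_subset_right)⟩
  exact ⟨h, ⟨0, fun k' _ => key k'⟩, fun _ _ _ => key⟩

theorem SS_of {n : ℕ} {ψ : Sent N (Fin (n + 1))}
    (h : EntailsDeg n (GammaN (n + 1) (Nat.succ_pos n)) ψ) : SS n ψ := by
  induction h with
  | @hyp φ h =>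
    have he : entails (GammaN (n + 1) (Nat.succ_pos n)) φ := fun M hM => hM _ h
    rcases mem_Gamma h with rfl | ⟨i, j, hij, rfl⟩ | rfl
    · exact SS_some he 0 ⟨(), MM_mem _ _ le_rfl _ _, MM_mem _ _ le_rfl _ _⟩
    · exact SS_all he
    · exact SS_all he
  | @step φ l hl _ hφ ih =>
    have he : entails (GammaN (n + 1) (Nat.succ_pos n)) φ :=
      fun M hM => hφ M (fun ψ hψ => (ih ψ hψ).1 M hM)
    cases φ with
    | allS x y => exact SS_all he
    | someS x y =>
      have : ∀ ψ : Sent N (Fin (n + 1)), ∃ k, ψ ∈ l → ∀ k', k' ≠ k → (MM n k').sat ψ := by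
        intro ψ
        by_cases hψ : ψ ∈ l
        · obtain ⟨k, hk⟩ := (ih ψ hψ).2.1
          exact ⟨k, fun _ => hk⟩
        · exact ⟨0, fun h => absurd h hψ⟩
      choose f hf using this
      obtain ⟨k, hk⟩ : ∃ k, k ∉ (l.map f).toFinset := by
        by_contra hc
        push Not at hc
        have h1 : (l.map f).toFinset = Finset.univ := by
          ext k
          simpa using hc k
        have h2 := List.toFinset_card_le (l.map f)
        rw [h1] at h2
        simp at h2
        omega
      refine SS_some he k (hφ _ fun ψ hψ => hf ψ hψ k ?_)
      rintro rfl
      exact hk (by simpa using ⟨ψ, hψ, rfl⟩)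

theorem Gamma_some (n : ℕ) :
    entails (GammaN (n + 1) (Nat.succ_pos n)) (Sent.someS ta ta) := by
  intro M hM
  by_contra hc
  have ha : ∀ m, m ∉ Tm.interp M (ta : Tm N (Fin (n + 1))) := fun m hm => hc ⟨m, hm, hm⟩
  have h1 : ∀ j : Fin (n + 1), (Tm.interp M (Tm.allT j (Tm.allT j ta))).Nonempty →
      (Tm.interp M (Tm.allT j tb)).Nonempty := by
    rintro j ⟨m, hm⟩
    exact ⟨m, fun y _ => hm y (fun z hz => absurd hz (ha z))⟩
  have h2 : ∀ i (hi : i < n + 1), (Tm.interp M (Tm.allT ⟨i, hi⟩ tb)).Nonempty := by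
    intro i
    induction i with
    | zero =>
      intro hi
      apply h1
      obtain ⟨m, hm, _⟩ := hM _ (Or.inl (Or.inl rfl))
      exact ⟨m, hm⟩
    | succ i ih =>
      intro hi
      apply h1
      exact (ih (by omega)).mono
        (hM _ (Or.inl (Or.inr ⟨⟨i, by omega⟩, ⟨i + 1, hi⟩, rfl, rfl⟩)))
  obtain ⟨m, hm⟩ := h2 n (by omega)
  exact ha m (hM _ (Or.inr rfl) hm)

/-- For every n, there are a finite L2 theory Γ and sentence φ with Γ ⊨ φ but Γ ⊭ₙ φ;
specifically Γₙ₊₁ ⊨ (some a a) and Γₙ₊₁ ⊭ₙ (some a a). -/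
theorem stmt9 (n : ℕ) :
    entails (GammaN (n + 1) (Nat.succ_pos n)) (Sent.someS ta ta) ∧
    ¬ EntailsDeg n (GammaN (n + 1) (Nat.succ_pos n)) (Sent.someS ta ta) := by
  exact ⟨Gamma_some n, fun h => by
    obtain ⟨m, hm, _⟩ := (SS_of h).2.2 _ _ rfl 0
    exact hm⟩
end

section
/- Suppose C = ((all a u₁), (all v₁ u₂), …, (all vₘ b)) is a chain linking a to b, the model M satisfies every sentence in C, and ⟦t⟧ = ∅ for every missing link term t of C. Then ⟦a⟧ ⊆ ⟦b⟧. -/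
/-- The condition linking uᵢ and vᵢ in a chain, with missing link term t:
either (1) uᵢ = (r⃗ all zᵢ) and vᵢ = (r⃗ all (r all t)) with r⃗ of even length, or
(2) uᵢ = (r⃗ all (r all t)) and vᵢ = (r⃗ all zᵢ) with r⃗ of odd length. -/
def LinkPair {P R : Type} (u v t : Tm P R) : Prop :=
  ∃ (rs : List R) (r : R) (z : Tm P R),
    (Even rs.length ∧ u = allVec rs z ∧ v = allVec rs (Tm.allT r t)) ∨
    (¬ Even rs.length ∧ u = allVec rs (Tm.allT r t) ∧ v = allVec rs z)

/-- A chain linking a to b, given by its terms u₁,…,uₘ, v₁,…,vₘ and its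
missing link terms t₁,…,tₘ. -/
structure Chain (P R : Type) where
  a : Tm P R
  b : Tm P R
  us : List (Tm P R)
  vs : List (Tm P R)
  ts : List (Tm P R)
  hvs : vs.length = us.length
  hts : ts.length = us.length
  link : ∀ i : Fin us.length,
    LinkPair (us.get i) (vs.get (Fin.cast hvs.symm i)) (ts.get (Fin.cast hts.symm i))

/-- The sentences of the chain: (all a u₁), (all v₁ u₂), …, (all vₘ b). -/
def Chain.sents {P R : Type} (C : Chain P R) : List (Sent P R) :=
  List.zipWith Sent.allS (C.a :: C.vs) (C.us ++ [C.b])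

theorem allVec_mono {P R : Type} (M : Model P R) (rs : List R) :
    ∀ x y : Tm P R, Tm.interp M x ⊆ Tm.interp M y →
      (Even rs.length → Tm.interp M (allVec rs x) ⊆ Tm.interp M (allVec rs y)) ∧
      (¬ Even rs.length → Tm.interp M (allVec rs y) ⊆ Tm.interp M (allVec rs x)) := by
  induction rs with
  | nil => intro x y h; simpa [allVec] using h
  | cons r rs ih =>
    intro x y h
    obtain ⟨h1, h2⟩ := ih x y h
    constructor
    · intro he m hm n hn
      have : ¬ Even rs.length := by
        simpa [Nat.even_add_one] using he
      exact hm n (h2 this hn)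
    · intro he m hm n hn
      have : Even rs.length := by
        by_contra hc
        exact he (by simpa [Nat.even_add_one] using hc)
      exact hm n (h1 this hn)

theorem linkPair_subset {P R : Type} (M : Model P R) {u v t : Tm P R}
    (h : LinkPair u v t) (ht : Tm.interp M t = ∅) :
    Tm.interp M u ⊆ Tm.interp M v := by
  obtain ⟨rs, r, z, h⟩ := h
  have hz : Tm.interp M z ⊆ Tm.interp M (Tm.allT r t) := by
    intro m _ n hn
    rw [ht] at hn
    exact hn.elim
  rcases h with ⟨he, rfl, rfl⟩ | ⟨he, rfl, rfl⟩
  · exact (allVec_mono M rs _ _ hz).1 he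
  · exact (allVec_mono M rs _ _ hz).2 he

theorem chain_lists {P R : Type} (M : Model P R) (b : Tm P R) (us : List (Tm P R)) :
    ∀ (a : Tm P R) (vs : List (Tm P R)) (hvs : vs.length = us.length),
      (∀ i : Fin us.length, Tm.interp M (us.get i) ⊆
        Tm.interp M (vs.get (Fin.cast hvs.symm i))) →
      (∀ s ∈ List.zipWith Sent.allS (a :: vs) (us ++ [b]), M.sat s) →
      Tm.interp M a ⊆ Tm.interp M b := by
  induction us with
  | nil =>
    intro a vs hvs _ hs
    exact hs (Sent.allS a b) (by simp)
  | cons u us ih =>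
    intro a vs hvs hl hs
    cases vs with
    | nil => simp at hvs
    | cons v vs =>
      have h1 : Tm.interp M a ⊆ Tm.interp M u := hs (Sent.allS a u) (by simp)
      have h2 : Tm.interp M u ⊆ Tm.interp M v := hl ⟨0, by simp⟩
      have h3 : Tm.interp M v ⊆ Tm.interp M b := by
        refine ih v vs (by simpa using hvs) (fun i => hl i.succ) ?_
        intro s hm
        exact hs s (List.mem_cons_of_mem _ hm)
      exact h1.trans (h2.trans h3)

/-- If C is a chain linking a to b, M satisfies every sentence of C, and every
missing link term of C has empty interpretation, then ⟦a⟧ ⊆ ⟦b⟧. -/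
theorem stmt12 {P R : Type} (C : Chain P R) (M : Model P R)
    (hsat : ∀ s ∈ C.sents, M.sat s)
    (hml : ∀ t ∈ C.ts, Tm.interp M t = ∅) :
    Tm.interp M C.a ⊆ Tm.interp M C.b := by
  exact chain_lists M C.b C.us C.a C.vs C.hvs
    (fun i => linkPair_subset M (C.link i) (hml _ (List.get_mem _ _))) hsat
end

section
/- The proof system ⊢₀ together with the (Chains) rule schema is complete for L2: if Γ ⊨ φ, then Γ ⊢ φ. -/
/-- An (x,y) chain system: a sequence of chains such that for every missing link
term t of the n-th chain there are earlier chains linking t to x and t to y. -/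
def ChainSystem {P R : Type} (x y : Tm P R) (Cs : List (Chain P R)) : Prop :=
  ∀ n : Fin Cs.length, ∀ t ∈ (Cs.get n).ts,
    (∃ m : Fin Cs.length, m.1 < n.1 ∧ (Cs.get m).a = t ∧ (Cs.get m).b = x) ∧
    (∃ m : Fin Cs.length, m.1 < n.1 ∧ (Cs.get m).a = t ∧ (Cs.get m).b = y)

/-- The rules of ⊢₀ together with the (Chains) rule schema. -/
inductive ProvesCh {P R : Type} (Γ : Set (Sent P R)) : Sent P R → Prop
  | hyp {φ} : φ ∈ Γ → ProvesCh Γ φ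
  | ax (x : Tm P R) : ProvesCh Γ (Sent.allS x x)
  | barbara {x y z} : ProvesCh Γ (Sent.allS x y) → ProvesCh Γ (Sent.allS y z) →
      ProvesCh Γ (Sent.allS x z)
  | anti {x y} (r : R) : ProvesCh Γ (Sent.allS x y) →
      ProvesCh Γ (Sent.allS (Tm.allT r y) (Tm.allT r x))
  | some1 {x y} : ProvesCh Γ (Sent.someS x y) → ProvesCh Γ (Sent.someS x x)
  | some2 {x y} : ProvesCh Γ (Sent.someS x y) → ProvesCh Γ (Sent.someS y x)
  | darii {x y z} : ProvesCh Γ (Sent.someS x y) → ProvesCh Γ (Sent.allS y z) →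
      ProvesCh Γ (Sent.someS x z)
  | chains {x y a b : Tm P R} (Cs : List (Chain P R)) :
      ChainSystem x y Cs →
      ProvesCh Γ (Sent.someS a b) →
      (∀ C ∈ Cs, ∀ s ∈ C.sents, ProvesCh Γ s) →
      (∃ m : Fin Cs.length, (Cs.get m).a = a ∧ (Cs.get m).b = x) →
      (∃ m : Fin Cs.length, (Cs.get m).a = b ∧ (Cs.get m).b = y) →
      ProvesCh Γ (Sent.someS x y)

namespace ChainsCompl

variable {P R : Type}

/-- Some chain of the list links `t` to `x`. -/
def Has (Cs : List (Chain P R)) (t x : Tm P R) : Prop :=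
  ∃ C ∈ Cs, C.a = t ∧ C.b = x

/-- Inductive version of chain systems all of whose sentences are provable. -/
inductive Sys (Γ : Set (Sent P R)) (x y : Tm P R) : List (Chain P R) → Prop
  | nil : Sys Γ x y []
  | snoc {Cs : List (Chain P R)} {C : Chain P R} : Sys Γ x y Cs →
      (∀ t ∈ C.ts, Has Cs t x ∧ Has Cs t y) → (∀ s ∈ C.sents, ProvesCh Γ s) →
      Sys Γ x y (Cs ++ [C])

theorem Has.left {Cs Ds : List (Chain P R)} {t x : Tm P R} (h : Has Cs t x) :
    Has (Cs ++ Ds) t x := by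
  obtain ⟨C, hC, h⟩ := h
  exact ⟨C, List.mem_append_left _ hC, h⟩

theorem Has.right {Cs Ds : List (Chain P R)} {t x : Tm P R} (h : Has Ds t x) :
    Has (Cs ++ Ds) t x := by
  obtain ⟨C, hC, h⟩ := h
  exact ⟨C, List.mem_append_right _ hC, h⟩

theorem Sys.append {Γ : Set (Sent P R)} {x y : Tm P R} {Cs Ds : List (Chain P R)}
    (h1 : Sys Γ x y Cs) (h2 : Sys Γ x y Ds) : Sys Γ x y (Cs ++ Ds) := by
  induction h2 with
  | nil => simpa using h1
  | snoc _ h hs ih =>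
    rw [← List.append_assoc]
    exact Sys.snoc ih (fun t ht => ⟨(h t ht).1.right, (h t ht).2.right⟩) hs

theorem Sys.prov {Γ : Set (Sent P R)} {x y : Tm P R} {Cs : List (Chain P R)}
    (h1 : Sys Γ x y Cs) : ∀ C ∈ Cs, ∀ s ∈ C.sents, ProvesCh Γ s := by
  induction h1 with
  | nil => simp
  | snoc _ h hs ih =>
    intro C hC
    rcases List.mem_append.1 hC with hC | hC
    · exact ih C hC
    · rw [List.mem_singleton.1 hC]; exact hs

theorem Has.idx {Cs : List (Chain P R)} {t x : Tm P R} (h : Has Cs t x) :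
    ∃ m : Fin Cs.length, (Cs.get m).a = t ∧ (Cs.get m).b = x := by
  obtain ⟨C, hC, h⟩ := h
  obtain ⟨m, rfl⟩ := List.mem_iff_get.1 hC
  exact ⟨m, h⟩

theorem Sys.system {Γ : Set (Sent P R)} {x y : Tm P R} {Cs : List (Chain P R)}
    (h1 : Sys Γ x y Cs) : ChainSystem x y Cs := by
  induction h1 with
  | nil => intro n; exact n.elim0
  | @snoc Cs C _ h hs ih =>
    have key : ∀ (k : ℕ) (m : Fin Cs.length) (u v : Tm P R), m.1 < k →
        (Cs.get m).a = u → (Cs.get m).b = v →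
        ∃ m : Fin (Cs ++ [C]).length, m.1 < k ∧ ((Cs ++ [C]).get m).a = u ∧
          ((Cs ++ [C]).get m).b = v := by
      rintro k ⟨m, hm⟩ u v hk h1 h2
      refine ⟨⟨m, by simp; omega⟩, hk, ?_, ?_⟩
      · simpa [List.getElem_append_left hm] using h1
      · simpa [List.getElem_append_left hm] using h2
    rintro ⟨n, hn⟩ t ht
    by_cases hc : n < Cs.length
    · have ht' : t ∈ (Cs.get ⟨n, hc⟩).ts := by
        simpa [List.getElem_append_left hc] using ht
      obtain ⟨⟨m, a1, a2, a3⟩, ⟨m', b1, b2, b3⟩⟩ := ih ⟨n, hc⟩ t ht'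
      exact ⟨key n m _ _ a1 a2 a3, key n m' _ _ b1 b2 b3⟩
    · have hn' : n = Cs.length := by simp at hn; omega
      subst hn'
      have ht' : t ∈ C.ts := by simpa using ht
      obtain ⟨h1, h2⟩ := h t ht'
      obtain ⟨m, a2, a3⟩ := h1.idx
      obtain ⟨m', b2, b3⟩ := h2.idx
      exact ⟨key _ m _ _ m.2 a2 a3, key _ m' _ _ m'.2 b2 b3⟩

/-- Inductive version of chains with provable sentences, missing links in `T`. -/
inductive CP (Γ : Set (Sent P R)) (T : Tm P R → Prop) : Tm P R → Tm P R → Prop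
  | nil {a b} : ProvesCh Γ (Sent.allS a b) → CP Γ T a b
  | cons {a u v t b} : ProvesCh Γ (Sent.allS a u) → LinkPair u v t → T t →
      CP Γ T v b → CP Γ T a b

theorem CP.mono {Γ : Set (Sent P R)} {T T' : Tm P R → Prop} (hT : ∀ t, T t → T' t)
    {a b : Tm P R} (h : CP Γ T a b) : CP Γ T' a b := by
  induction h with
  | nil h => exact .nil h
  | cons h1 h2 h3 _ ih => exact .cons h1 h2 (hT _ h3) ih

theorem CP.pre {Γ : Set (Sent P R)} {T : Tm P R → Prop} {a b c : Tm P R}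
    (h0 : ProvesCh Γ (Sent.allS a b)) (h : CP Γ T b c) : CP Γ T a c := by
  cases h with
  | nil h => exact .nil (.barbara h0 h)
  | cons h1 h2 h3 h4 => exact .cons (.barbara h0 h1) h2 h3 h4

theorem CP.trans {Γ : Set (Sent P R)} {T : Tm P R → Prop} {a b c : Tm P R}
    (h : CP Γ T a b) (h' : CP Γ T b c) : CP Γ T a c := by
  induction h with
  | nil h => exact h'.pre h
  | cons h1 h2 h3 _ ih => exact .cons h1 h2 h3 (ih h')

theorem LinkPair.anti {u v t : Tm P R} (r : R) (h : LinkPair u v t) :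
    LinkPair (Tm.allT r v) (Tm.allT r u) t := by
  obtain ⟨rs, r', z, ⟨h1, h2, h3⟩ | ⟨h1, h2, h3⟩⟩ := h
  · refine ⟨r :: rs, r', z, Or.inr ⟨?_, ?_, ?_⟩⟩
    · simpa [Nat.even_add_one] using h1
    · rw [h3]; rfl
    · rw [h2]; rfl
  · refine ⟨r :: rs, r', z, Or.inl ⟨?_, ?_, ?_⟩⟩
    · simpa [Nat.even_add_one] using h1
    · rw [h3]; rfl
    · rw [h2]; rfl

theorem CP.anti {Γ : Set (Sent P R)} {T : Tm P R → Prop} {a b : Tm P R} (r : R)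
    (h : CP Γ T a b) : CP Γ T (Tm.allT r b) (Tm.allT r a) := by
  induction h with
  | nil h => exact .nil (.anti r h)
  | cons h1 h2 h3 _ ih =>
    exact ih.trans (.cons (.ax _) (LinkPair.anti r h2) h3 (.nil (.anti r h1)))

theorem CP.chain {Γ : Set (Sent P R)} {T : Tm P R → Prop} {a b : Tm P R}
    (h : CP Γ T a b) : ∃ C : Chain P R, C.a = a ∧ C.b = b ∧ (∀ t ∈ C.ts, T t) ∧
      ∀ s ∈ C.sents, ProvesCh Γ s := by
  induction h with
  | @nil a b h =>
    refine ⟨⟨a, b, [], [], [], rfl, rfl, fun i => i.elim0⟩, rfl, rfl, by simp, ?_⟩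
    simpa [Chain.sents] using h
  | @cons a u v t b h1 h2 h3 _ ih =>
    obtain ⟨⟨a', b', us, vs, ts, hvs, hts, hl⟩, rfl, rfl, hT, hs⟩ := ih
    refine ⟨⟨a, b', u :: us, a' :: vs, t :: ts, by simpa using hvs, by simpa using hts, ?_⟩,
      rfl, rfl, ?_, ?_⟩
    · rintro ⟨i, hi⟩
      cases i with
      | zero => exact h2
      | succ i => exact hl ⟨i, by simpa using hi⟩
    · intro s hs
      rcases List.mem_cons.1 hs with rfl | hs
      · exact h3
      · exact hT s hs
    · intro s hs'
      rcases List.mem_cons.1 hs' with rfl | hs'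
      · exact h1
      · exact hs s hs'

/-- The preorder forced by provability and emptiness of the meet of `x` and `y`. -/
inductive Le (Γ : Set (Sent P R)) (x y : Tm P R) : Tm P R → Tm P R → Prop
  | base {a b} : ProvesCh Γ (Sent.allS a b) → Le Γ x y a b
  | trans {a b c} : Le Γ x y a b → Le Γ x y b c → Le Γ x y a c
  | anti {a b} (r : R) : Le Γ x y a b → Le Γ x y (Tm.allT r b) (Tm.allT r a)
  | empty {t} (z : Tm P R) (r : R) : Le Γ x y t x → Le Γ x y t y → Le Γ x y z (Tm.allT r t)

theorem sys_of_CP {Γ : Set (Sent P R)} {x y a b : Tm P R} {Cs : List (Chain P R)}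
    (hs : Sys Γ x y Cs) (h : CP Γ (fun t => Has Cs t x ∧ Has Cs t y) a b) :
    ∃ Ds, Sys Γ x y Ds ∧ Has Ds a b := by
  obtain ⟨C, h1, h2, h3, h4⟩ := h.chain
  exact ⟨Cs ++ [C], .snoc hs h3 h4, C, by simp, h1, h2⟩

theorem Le.cp {Γ : Set (Sent P R)} {x y a b : Tm P R} (h : Le Γ x y a b) :
    ∃ Cs, Sys Γ x y Cs ∧ CP Γ (fun t => Has Cs t x ∧ Has Cs t y) a b := by
  induction h with
  | base h => exact ⟨[], .nil, .nil h⟩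
  | trans _ _ ih1 ih2 =>
    obtain ⟨Cs, s1, c1⟩ := ih1
    obtain ⟨Ds, s2, c2⟩ := ih2
    exact ⟨Cs ++ Ds, s1.append s2,
      (c1.mono fun t h => ⟨h.1.left, h.2.left⟩).trans
        (c2.mono fun t h => ⟨h.1.right, h.2.right⟩)⟩
  | anti r _ ih =>
    obtain ⟨Cs, s1, c1⟩ := ih
    exact ⟨Cs, s1, c1.anti r⟩
  | @empty t z r _ _ ih1 ih2 =>
    obtain ⟨Cs, s1, c1⟩ := ih1
    obtain ⟨Ds, s2, c2⟩ := ih2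
    obtain ⟨Cs, s1, c1⟩ := sys_of_CP s1 c1
    obtain ⟨Ds, s2, c2⟩ := sys_of_CP s2 c2
    refine ⟨Cs ++ Ds, s1.append s2, .cons (t := t) (.ax z)
      ⟨[], r, z, Or.inl ⟨by simp, rfl, rfl⟩⟩ ⟨c1.left, c2.right⟩ (.nil (.ax _))⟩

theorem some_of_Le {Γ : Set (Sent P R)} {x y a b : Tm P R}
    (hab : ProvesCh Γ (Sent.someS a b)) (h1 : Le Γ x y a x) (h2 : Le Γ x y b y) :
    ProvesCh Γ (Sent.someS x y) := by
  obtain ⟨Cs, s1, c1⟩ := h1.cp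
  obtain ⟨Ds, s2, c2⟩ := h2.cp
  obtain ⟨Cs, s1, c1⟩ := sys_of_CP s1 c1
  obtain ⟨Ds, s2, c2⟩ := sys_of_CP s2 c2
  have s := s1.append s2
  exact .chains (Cs ++ Ds) s.system hab s.prov (Has.left c1).idx (Has.right c2).idx

/-- Canonical model: worlds are pairs of terms satisfying `G`, ordered via `L`. -/
def canon (L : Tm P R → Tm P R → Prop) (G : Tm P R → Tm P R → Prop) : Model P R where
  W := {p : Tm P R × Tm P R // G p.1 p.2}
  nounI p := {w | L w.1.1 (.noun p) ∨ L w.1.2 (.noun p)}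
  verbI r w w' := ∃ t, (L w'.1.1 t ∨ L w'.1.2 t) ∧
    (L w.1.1 (.allT r t) ∨ L w.1.2 (.allT r t))

theorem canon_interp (L : Tm P R → Tm P R → Prop) (G : Tm P R → Tm P R → Prop)
    (hr : ∀ a, L a a) (ht : ∀ a b c, L a b → L b c → L a c)
    (ha : ∀ r a b, L a b → L (.allT r b) (.allT r a))
    (hG : ∀ t, G t t ∨ ∀ z r, L z (.allT r t)) (t : Tm P R) :
    ∀ w : (canon L G).W, w ∈ Tm.interp (canon L G) t ↔ (L w.1.1 t ∨ L w.1.2 t) := by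
  induction t with
  | noun p => intro w; rfl
  | allT r t ih =>
    intro w
    constructor
    · intro h
      rcases hG t with hg | hg
      · obtain ⟨t', h1, h2⟩ := h ⟨(t, t), hg⟩ ((ih _).2 (Or.inl (hr t)))
        have h1' : L t t' := by simpa using h1
        exact h2.imp (fun h => ht _ _ _ h (ha r _ _ h1')) (fun h => ht _ _ _ h (ha r _ _ h1'))
      · exact Or.inl (hg _ _)
    · intro h n hn
      exact ⟨t, (ih n).1 hn, h⟩

end ChainsCompl

open ChainsCompl in
/-- Completeness of ⊢₀ together with the (Chains) schema: if Γ ⊨ φ then Γ ⊢ φ. -/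
theorem stmt13 {P R : Type} (Γ : Set (Sent P R)) (φ : Sent P R)
    (h : entails Γ φ) : ProvesCh Γ φ := by
  cases φ with
  | allS x y =>
    let L : Tm P R → Tm P R → Prop := fun a b => ProvesCh Γ (Sent.allS a b)
    have I := canon_interp L (fun _ _ => True) (fun a => .ax a)
      (fun a b c h1 h2 => .barbara h1 h2) (fun r a b h => .anti r h) (fun t => Or.inl trivial)
    have := h (canon L fun _ _ => True) (by
      intro ψ hψ
      cases ψ with
      | allS a b =>
        intro w hw
        exact (I b w).2 (((I a w).1 hw).imp (fun h => .barbara h (.hyp hψ))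
          (fun h => .barbara h (.hyp hψ)))
      | someS a b =>
        exact ⟨⟨(a, b), trivial⟩, (I a _).2 (Or.inl (.ax a)), (I b _).2 (Or.inr (.ax b))⟩)
    have h2 := (I y ⟨(x, x), trivial⟩).1 (this ((I x _).2 (Or.inl (.ax x))))
    exact h2.elim id id
  | someS x y =>
    by_contra hn
    let L : Tm P R → Tm P R → Prop := Le Γ x y
    let G : Tm P R → Tm P R → Prop := fun a b => ¬ ((L a x ∨ L b x) ∧ (L a y ∨ L b y))
    have I := canon_interp L G (fun a => .base (.ax a))
      (fun a b c h1 h2 => .trans h1 h2) (fun r a b h => .anti r h) (fun t => by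
        by_cases ht : L t x ∧ L t y
        · exact Or.inr fun z r => .empty z r ht.1 ht.2
        · left
          simpa [G] using ht)
    have := h (canon L G) (by
      intro ψ hψ
      cases ψ with
      | allS a b =>
        intro w hw
        exact (I b w).2 (((I a w).1 hw).imp (fun h => .trans h (.base (.hyp hψ)))
          (fun h => .trans h (.base (.hyp hψ))))
      | someS a b =>
        have hab : ProvesCh Γ (Sent.someS a b) := .hyp hψ
        have hg : G a b := by
          rintro ⟨h1 | h1, h2 | h2⟩
          · exact hn (some_of_Le hab.some1 h1 h2)
          · exact hn (some_of_Le hab h1 h2)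
          · exact hn (some_of_Le hab.some2 h1 h2)
          · exact hn (some_of_Le hab.some2.some1 h1 h2)
        exact ⟨⟨(a, b), hg⟩, (I a _).2 (Or.inl (.base (.ax a))),
          (I b _).2 (Or.inr (.base (.ax b)))⟩)
    obtain ⟨w, hx, hy⟩ := this
    exact w.2 ⟨(I x w).1 hx, (I y w).1 hy⟩
end

section
/- The set S of clauses has a 1-valued assignment if and only if Γ(S) ⊭ (all start finish). -/
/-- Terms of L3: nouns, (r all x), and (r some x). -/
inductive Tm3 (P R : Type) : Type
  | noun : P → Tm3 P R
  | allT : R → Tm3 P R → Tm3 P R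
  | someT : R → Tm3 P R → Tm3 P R

/-- Sentences of L3: (all x y). -/
inductive Sent3 (P R : Type) : Type
  | allS : Tm3 P R → Tm3 P R → Sent3 P R

structure Model3 (P R : Type) where
  W : Type
  nounI : P → Set W
  verbI : R → W → W → Prop

def Tm3.interp {P R : Type} (M : Model3 P R) : Tm3 P R → Set M.W
  | .noun p => M.nounI p
  | .allT r x => {m | ∀ n ∈ Tm3.interp M x, M.verbI r m n}
  | .someT r x => {m | ∃ n ∈ Tm3.interp M x, M.verbI r m n}

def Model3.sat {P R : Type} (M : Model3 P R) : Sent3 P R → Prop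
  | .allS x y => Tm3.interp M x ⊆ Tm3.interp M y

def entails3 {P R : Type} (Γ : Set (Sent3 P R)) (φ : Sent3 P R) : Prop :=
  ∀ M : Model3 P R, (∀ ψ ∈ Γ, M.sat ψ) → M.sat φ

/-- The nouns used in the encoding: a noun for each variable, the nouns start and
finish, and nouns y_c, z_c for each clause c. -/
inductive N3 (V : Type) : Type
  | var : V → N3 V
  | start : N3 V
  | finish : N3 V
  | y : V × V × V → N3 V
  | z : V × V × V → N3 V

/-- The verbs used in the encoding: r¹_c, r²_c, r³_c for each clause c, and
r_{p,q}, r′_{p,q} for each ordered pair of variables. -/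
inductive Vb3 (V : Type) : Type
  | r1 : V × V × V → Vb3 V
  | r2 : V × V × V → Vb3 V
  | r3 : V × V × V → Vb3 V
  | rr : V → V → Vb3 V
  | rr' : V → V → Vb3 V

/-- The noun corresponding to a variable, as a term. -/
def nvar {V : Type} (u : V) : Tm3 (N3 V) (Vb3 V) := Tm3.noun (N3.var u)

/-- The variable p occurs in the clause c. -/
def occursIn {V : Type} (p : V) (c : V × V × V) : Prop :=
  p = c.1 ∨ p = c.2.1 ∨ p = c.2.2

/-- The L3 theory Γ(S) associated to a set S of clauses. -/
def GammaS {V : Type} (S : Set (V × V × V)) : Set (Sent3 (N3 V) (Vb3 V)) :=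
  {s | ∃ c ∈ S,
        s = Sent3.allS (Tm3.noun N3.start) (Tm3.allT (Vb3.r1 c) (nvar c.1)) ∨
        s = Sent3.allS (Tm3.someT (Vb3.r1 c) (nvar c.1)) (Tm3.noun (N3.y c)) ∨
        s = Sent3.allS (Tm3.noun (N3.y c)) (Tm3.allT (Vb3.r2 c) (nvar c.2.1)) ∨
        s = Sent3.allS (Tm3.someT (Vb3.r2 c) (nvar c.2.1)) (Tm3.noun (N3.z c)) ∨
        s = Sent3.allS (Tm3.noun (N3.z c)) (Tm3.allT (Vb3.r3 c) (nvar c.2.2)) ∨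
        s = Sent3.allS (Tm3.someT (Vb3.r3 c) (nvar c.2.2)) (Tm3.noun N3.finish)} ∪
  {s | ∃ p q : V, p ≠ q ∧ (∃ c ∈ S, occursIn p c ∧ occursIn q c) ∧
        s = Sent3.allS (Tm3.allT (Vb3.rr p q) (nvar p)) (Tm3.someT (Vb3.rr' p q) (nvar q))}

/-- f is a 1-valued assignment for S: exactly one variable of each clause is true. -/
def OneValued {V : Type} (S : Set (V × V × V)) (f : V → Prop) : Prop :=
  ∀ c ∈ S, (f c.1 ∧ ¬ f c.2.1 ∧ ¬ f c.2.2) ∨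
           (¬ f c.1 ∧ f c.2.1 ∧ ¬ f c.2.2) ∨
           (¬ f c.1 ∧ ¬ f c.2.1 ∧ f c.2.2)

/-- The one-point countermodel attached to an assignment. -/
def ptModel {V : Type} (f : V → Prop) : Model3 (N3 V) (Vb3 V) where
  W := Unit
  nounI := fun n => match n with
    | .var u => {_x | ¬ f u}
    | .start => {_x | True}
    | .finish => {_x | False}
    | .y c => {_x | ¬ f c.1}
    | .z c => {_x | ¬ f c.1 ∧ ¬ f c.2.1}
  verbI := fun r _ _ => match r with
    | .r1 _ => True
    | .r2 c => ¬ f c.1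
    | .r3 c => ¬ f c.1 ∧ ¬ f c.2.1
    | .rr _ _ => False
    | .rr' _ _ => True

/-- S has a 1-valued assignment iff Γ(S) ⊭ (all start finish). -/
theorem stmt15 {V : Type} (S : Set (V × V × V)) (hfin : S.Finite)
    (hdist : ∀ c ∈ S, c.1 ≠ c.2.1 ∧ c.1 ≠ c.2.2 ∧ c.2.1 ≠ c.2.2) :
    (∃ f : V → Prop, OneValued S f) ↔
      ¬ entails3 (GammaS S) (Sent3.allS (Tm3.noun N3.start) (Tm3.noun N3.finish)) := by
  constructor
  · rintro ⟨f, hf⟩ h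
    have key := h (ptModel f) ?_
    · exact key (show () ∈ {_x : Unit | True} from trivial)
    · rintro ψ (⟨c, hc, rfl | rfl | rfl | rfl | rfl | rfl⟩ | ⟨p, q, hpq, ⟨c, hc, hp, hq⟩, rfl⟩)
      · intro x _ n _
        trivial
      · rintro x ⟨n, hn, _⟩
        exact hn
      · intro x hx n _
        exact hx
      · rintro x ⟨n, hn, hr⟩
        exact ⟨hr, hn⟩
      · intro x hx n _
        exact hx
      · rintro x ⟨n, hn, hr⟩
        have hn' : ¬ f c.2.2 := hn
        have hr' : ¬ f c.1 ∧ ¬ f c.2.1 := hr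
        have := hf c hc
        exfalso
        tauto
      · intro x hx
        have hfp : f p := by
          by_contra hcon
          exact hx () hcon
        refine ⟨(), ?_, trivial⟩
        show ¬ f q
        have := hf c hc
        intro hfq
        rcases hp with rfl | rfl | rfl <;> rcases hq with rfl | rfl | rfl <;> tauto
  · intro h
    unfold entails3 at h
    push Not at h
    obtain ⟨M, hM, hn⟩ := h
    obtain ⟨x, hx, hxf⟩ := Set.not_subset.1 hn
    refine ⟨fun u => ¬ ∃ n, n ∈ M.nounI (N3.var u), ?_⟩
    intro c hc
    have hpair : ∀ p q : V, p ≠ q → occursIn p c → occursIn q c →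
        (∃ n, n ∈ M.nounI (N3.var p)) ∨ (∃ n, n ∈ M.nounI (N3.var q)) := by
      intro p q hpq hp hq
      by_contra hcon
      push Not at hcon
      have h1 := hM _ (Or.inr ⟨p, q, hpq, ⟨c, hc, hp, hq⟩, rfl⟩)
      obtain ⟨n, hn, _⟩ := h1 (show x ∈ Tm3.interp M (Tm3.allT (Vb3.rr p q) (nvar p)) from
        fun n hn => absurd hn (hcon.1 n))
      exact hcon.2 n hn
    have hall : ¬ ((∃ n, n ∈ M.nounI (N3.var c.1)) ∧ (∃ n, n ∈ M.nounI (N3.var c.2.1)) ∧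
        (∃ n, n ∈ M.nounI (N3.var c.2.2))) := by
      rintro ⟨⟨a, ha⟩, ⟨b, hb⟩, ⟨d, hd⟩⟩
      have h1 := hM _ (Or.inl ⟨c, hc, Or.inl rfl⟩)
      have h2 := hM _ (Or.inl ⟨c, hc, Or.inr (Or.inl rfl)⟩)
      have h3 := hM _ (Or.inl ⟨c, hc, Or.inr (Or.inr (Or.inl rfl))⟩)
      have h4 := hM _ (Or.inl ⟨c, hc, Or.inr (Or.inr (Or.inr (Or.inl rfl)))⟩)
      have h5 := hM _ (Or.inl ⟨c, hc, Or.inr (Or.inr (Or.inr (Or.inr (Or.inl rfl))))⟩)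
      have h6 := hM _ (Or.inl ⟨c, hc, Or.inr (Or.inr (Or.inr (Or.inr (Or.inr rfl))))⟩)
      have hy := h2 ⟨a, ha, h1 hx a ha⟩
      have hz := h4 ⟨b, hb, h3 hy b hb⟩
      exact hxf (h6 ⟨d, hd, h5 hz d hd⟩)
    obtain ⟨d1, d2, d3⟩ := hdist c hc
    have p1 := hpair _ _ d1 (Or.inl rfl) (Or.inr (Or.inl rfl))
    have p2 := hpair _ _ d2 (Or.inl rfl) (Or.inr (Or.inr rfl))
    have p3 := hpair _ _ d3 (Or.inr (Or.inl rfl)) (Or.inr (Or.inr rfl))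
    clear hpair
    dsimp only
    generalize (∃ n, n ∈ M.nounI (N3.var c.1)) = A at *
    generalize (∃ n, n ∈ M.nounI (N3.var c.2.1)) = B at *
    generalize (∃ n, n ∈ M.nounI (N3.var c.2.2)) = C at *
    tauto
end

section
/- The L3 proof system is sound and complete: for any L3 theory Γ and sentence φ, Γ ⊨ φ if and only if Γ ⊢ φ. -/
/-- The L3 proof system: (Axiom), (Barbara), (Anti), (R1), (Mix), together with the
assumption-withdrawing rules (Cases₃) and (Cases₂). -/
inductive Pr3 {P R : Type} : Set (Sent3 P R) → Sent3 P R → Prop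
  | hyp {Γ : Set (Sent3 P R)} {φ} : φ ∈ Γ → Pr3 Γ φ
  | ax {Γ : Set (Sent3 P R)} (x : Tm3 P R) : Pr3 Γ (Sent3.allS x x)
  | barbara {Γ : Set (Sent3 P R)} {x y z} : Pr3 Γ (Sent3.allS x y) →
      Pr3 Γ (Sent3.allS y z) → Pr3 Γ (Sent3.allS x z)
  | anti {Γ : Set (Sent3 P R)} {x y} (r : R) : Pr3 Γ (Sent3.allS x y) →
      Pr3 Γ (Sent3.allS (Tm3.allT r y) (Tm3.allT r x))
  | r1 {Γ : Set (Sent3 P R)} {x y} (r : R) : Pr3 Γ (Sent3.allS x y) →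
      Pr3 Γ (Sent3.allS (Tm3.someT r x) (Tm3.someT r y))
  | mix {Γ : Set (Sent3 P R)} {x y} (r s : R) :
      Pr3 Γ (Sent3.allS (Tm3.allT r y) (Tm3.someT r y)) →
      Pr3 Γ (Sent3.allS y (Tm3.someT r x)) →
      Pr3 Γ (Sent3.allS (Tm3.allT s x) (Tm3.someT s x))
  | cases3 {Γ : Set (Sent3 P R)} {φ} (x y : Tm3 P R) (r s : R) :
      Pr3 (insert (Sent3.allS (Tm3.allT r x) (Tm3.someT r x)) Γ) φ →
      Pr3 (insert (Sent3.allS y (Tm3.allT s x)) Γ) φ →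
      Pr3 Γ φ
  | cases2 {Γ : Set (Sent3 P R)} {φ} (x y : Tm3 P R) (r : R) :
      Pr3 (insert (Sent3.allS (Tm3.allT r x) (Tm3.someT r x)) Γ) φ →
      Pr3 (insert (Sent3.allS x y) Γ) φ →
      Pr3 Γ φ

namespace L3

variable {P R : Type}

theorem mono {Γ : Set (Sent3 P R)} {φ : Sent3 P R} (h : Pr3 Γ φ) :
    ∀ Δ : Set (Sent3 P R), Γ ⊆ Δ → Pr3 Δ φ := by
  induction h with
  | hyp h => exact fun Δ hs => Pr3.hyp (hs h)
  | ax x => exact fun Δ hs => Pr3.ax x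
  | barbara _ _ ih1 ih2 => exact fun Δ hs => Pr3.barbara (ih1 Δ hs) (ih2 Δ hs)
  | anti r _ ih => exact fun Δ hs => Pr3.anti r (ih Δ hs)
  | r1 r _ ih => exact fun Δ hs => Pr3.r1 r (ih Δ hs)
  | mix r s _ _ ih1 ih2 => exact fun Δ hs => Pr3.mix r s (ih1 Δ hs) (ih2 Δ hs)
  | cases3 x y r s _ _ ih1 ih2 =>
    exact fun Δ hs => Pr3.cases3 x y r s (ih1 _ (Set.insert_subset_insert hs))
      (ih2 _ (Set.insert_subset_insert hs))
  | cases2 x y r _ _ ih1 ih2 =>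
    exact fun Δ hs => Pr3.cases2 x y r (ih1 _ (Set.insert_subset_insert hs))
      (ih2 _ (Set.insert_subset_insert hs))

/-- Removing one assumption from a finite set used by a derivation. -/
theorem finite_remove {Γ Δ : Set (Sent3 P R)} {ψ : Sent3 P R} (hf : Δ.Finite)
    (hs : Δ ⊆ insert ψ Γ) : (Δ \ {ψ}).Finite ∧ Δ \ {ψ} ⊆ Γ ∧ Δ ⊆ insert ψ (Δ \ {ψ}) := by
  refine ⟨hf.subset Set.sdiff_subset, ?_, ?_⟩
  · rintro a ⟨ha, hne⟩
    exact (hs ha).resolve_left hne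
  · intro a ha
    by_cases h : a = ψ
    · exact Or.inl h
    · exact Or.inr ⟨ha, h⟩

theorem compact {Γ : Set (Sent3 P R)} {φ : Sent3 P R} (h : Pr3 Γ φ) :
    ∃ Δ : Set (Sent3 P R), Δ.Finite ∧ Δ ⊆ Γ ∧ Pr3 Δ φ := by
  induction h with
  | @hyp Γ φ h =>
    exact ⟨{φ}, Set.finite_singleton _, Set.singleton_subset_iff.2 h, Pr3.hyp rfl⟩
  | ax x => exact ⟨∅, Set.finite_empty, Set.empty_subset _, Pr3.ax x⟩
  | barbara _ _ ih1 ih2 =>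
    obtain ⟨A, fA, sA, pA⟩ := ih1
    obtain ⟨B, fB, sB, pB⟩ := ih2
    exact ⟨A ∪ B, fA.union fB, Set.union_subset sA sB,
      Pr3.barbara (mono pA _ Set.subset_union_left) (mono pB _ Set.subset_union_right)⟩
  | anti r _ ih =>
    obtain ⟨A, fA, sA, pA⟩ := ih
    exact ⟨A, fA, sA, Pr3.anti r pA⟩
  | r1 r _ ih =>
    obtain ⟨A, fA, sA, pA⟩ := ih
    exact ⟨A, fA, sA, Pr3.r1 r pA⟩
  | mix r s _ _ ih1 ih2 =>
    obtain ⟨A, fA, sA, pA⟩ := ih1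
    obtain ⟨B, fB, sB, pB⟩ := ih2
    exact ⟨A ∪ B, fA.union fB, Set.union_subset sA sB,
      Pr3.mix r s (mono pA _ Set.subset_union_left) (mono pB _ Set.subset_union_right)⟩
  | cases3 x y r s _ _ ih1 ih2 =>
    obtain ⟨A, fA, sA, pA⟩ := ih1
    obtain ⟨B, fB, sB, pB⟩ := ih2
    obtain ⟨fA', sA', iA⟩ := finite_remove fA sA
    obtain ⟨fB', sB', iB⟩ := finite_remove fB sB
    exact ⟨_, fA'.union fB', Set.union_subset sA' sB',
      Pr3.cases3 x y r s
        (mono pA _ (iA.trans (Set.insert_subset_insert Set.subset_union_left)))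
        (mono pB _ (iB.trans (Set.insert_subset_insert Set.subset_union_right)))⟩
  | cases2 x y r _ _ ih1 ih2 =>
    obtain ⟨A, fA, sA, pA⟩ := ih1
    obtain ⟨B, fB, sB, pB⟩ := ih2
    obtain ⟨fA', sA', iA⟩ := finite_remove fA sA
    obtain ⟨fB', sB', iB⟩ := finite_remove fB sB
    exact ⟨_, fA'.union fB', Set.union_subset sA' sB',
      Pr3.cases2 x y r
        (mono pA _ (iA.trans (Set.insert_subset_insert Set.subset_union_left)))
        (mono pB _ (iB.trans (Set.insert_subset_insert Set.subset_union_right)))⟩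

theorem exists_maximal {Γ : Set (Sent3 P R)} {φ : Sent3 P R} (h : ¬ Pr3 Γ φ) :
    ∃ Δ : Set (Sent3 P R), Γ ⊆ Δ ∧ ¬ Pr3 Δ φ ∧ ∀ ψ, ψ ∉ Δ → Pr3 (insert ψ Δ) φ := by
  obtain ⟨Δ, hΓ, hmax⟩ := zorn_subset_nonempty {Δ : Set (Sent3 P R) | ¬ Pr3 Δ φ} (by
    intro c hc hchain hne
    refine ⟨⋃₀ c, ?_, fun s hs => Set.subset_sUnion_of_mem hs⟩
    intro hp
    obtain ⟨A, fA, sA, pA⟩ := compact hp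
    obtain ⟨t, htc, hAt⟩ :=
      DirectedOn.exists_mem_subset_of_finite_of_subset_sUnion hne hchain.directedOn fA sA
    exact hc htc (mono pA _ hAt)) Γ h
  refine ⟨Δ, hΓ, hmax.prop, fun ψ hψ => ?_⟩
  by_contra hcon
  exact hψ (hmax.le_of_ge hcon (Set.subset_insert _ _) (Set.mem_insert _ _))

theorem sound {Γ : Set (Sent3 P R)} {φ : Sent3 P R} (h : Pr3 Γ φ) : entails3 Γ φ := by
  have key : ∀ (M : Model3 P R) (Γ : Set (Sent3 P R)) (ψ : Sent3 P R),
      (∀ χ ∈ Γ, M.sat χ) → M.sat ψ → ∀ χ ∈ insert ψ Γ, M.sat χ := by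
    rintro M Γ ψ h1 h2 χ (rfl | h)
    · exact h2
    · exact h1 _ h
  induction h with
  | hyp h => exact fun M hM => hM _ h
  | ax x => exact fun M hM => Set.Subset.rfl
  | barbara _ _ ih1 ih2 => exact fun M hM => Set.Subset.trans (ih1 M hM) (ih2 M hM)
  | anti r _ ih => exact fun M hM m hm n hn => hm n (ih M hM hn)
  | r1 r _ ih => exact fun M hM m ⟨n, hn, hr⟩ => ⟨n, ih M hM hn, hr⟩
  | @mix Γ x y r s _ _ ih1 ih2 =>
    intro M hM m hm
    have hy : ∃ n, n ∈ y.interp M := by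
      by_contra hcon
      obtain ⟨n, hn, -⟩ := ih1 M hM (a := m) (fun n hn => absurd ⟨n, hn⟩ hcon)
      exact hcon ⟨n, hn⟩
    obtain ⟨n, hn⟩ := hy
    obtain ⟨k, hk, -⟩ := ih2 M hM hn
    exact ⟨k, hk, hm k hk⟩
  | cases3 x y r s _ _ ih1 ih2 =>
    intro M hM
    by_cases hx : ∃ n, n ∈ x.interp M
    · obtain ⟨n, hn⟩ := hx
      exact ih1 M (key M _ _ hM fun m hm => ⟨n, hn, hm n hn⟩)
    · exact ih2 M (key M _ _ hM fun m _ n hn => absurd ⟨n, hn⟩ hx)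
  | cases2 x y r _ _ ih1 ih2 =>
    intro M hM
    by_cases hx : ∃ n, n ∈ x.interp M
    · obtain ⟨n, hn⟩ := hx
      exact ih1 M (key M _ _ hM fun m hm => ⟨n, hn, hm n hn⟩)
    · exact ih2 M (key M _ _ hM fun n hn => absurd ⟨n, hn⟩ hx)

/-- Derivable inclusion. -/
def Le (Δ : Set (Sent3 P R)) (x y : Tm3 P R) : Prop := Pr3 Δ (Sent3.allS x y)

/-- Terms that the theory takes to be nonempty. -/
def Ex (Δ : Set (Sent3 P R)) (x : Tm3 P R) : Prop :=
  ∀ r, Le Δ (Tm3.allT r x) (Tm3.someT r x)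

/-- The canonical model: two copies of each nonempty term; the copy `true` serves as a
witness for `some`. -/
def canon (Δ : Set (Sent3 P R)) : Model3 P R where
  W := {x : Tm3 P R // Ex Δ x} × Bool
  nounI p := {m | Le Δ m.1.1 (Tm3.noun p)}
  verbI r m n := Le Δ m.1.1 (Tm3.allT r n.1.1) ∨ (n.2 = true ∧ Le Δ m.1.1 (Tm3.someT r n.1.1))

theorem truth (Δ : Set (Sent3 P R))
    (hE : ∀ x, ¬ Ex Δ x → ∀ y s, Le Δ y (Tm3.allT s x)) (x : Tm3 P R) :
    ∀ m : {x : Tm3 P R // Ex Δ x} × Bool, m ∈ x.interp (canon Δ) ↔ Le Δ m.1.1 x := by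
  induction x with
  | noun p => exact fun m => Iff.rfl
  | allT r x ih =>
    intro m
    constructor
    · intro h
      by_cases hx : Ex Δ x
      · rcases h (⟨x, hx⟩, false) ((ih _).2 (Pr3.ax x)) with h | ⟨h, -⟩
        · exact h
        · cases h
      · exact hE x hx _ _
    · intro h n hn
      exact Or.inl (Pr3.barbara h (Pr3.anti r ((ih n).1 hn)))
  | someT r x ih =>
    intro m
    constructor
    · rintro ⟨n, hn, h | ⟨-, h⟩⟩
      · exact Pr3.barbara h (Pr3.barbara (n.1.2 r) (Pr3.r1 r ((ih n).1 hn)))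
      · exact Pr3.barbara h (Pr3.r1 r ((ih n).1 hn))
    · intro h
      have hx : Ex Δ x := fun s => Pr3.mix r s (m.1.2 r) h
      exact ⟨(⟨x, hx⟩, true), (ih _).2 (Pr3.ax x), Or.inr ⟨rfl, h⟩⟩

theorem complete {Γ : Set (Sent3 P R)} {φ : Sent3 P R} (h : entails3 Γ φ) : Pr3 Γ φ := by
  by_contra hcon
  obtain ⟨Δ, hΓ, hφ, hmax⟩ := exists_maximal hcon
  have hmax' : ∀ ψ, ¬ Pr3 Δ ψ → Pr3 (insert ψ Δ) φ := fun ψ hψ =>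
    hmax ψ fun hm => hψ (Pr3.hyp hm)
  have hE : ∀ x, ¬ Ex Δ x → ∀ y s, Le Δ y (Tm3.allT s x) := by
    intro x hx y s
    obtain ⟨r, hr⟩ := not_forall.1 hx
    by_contra hy
    exact hφ (Pr3.cases3 x y r s (hmax' _ hr) (hmax' _ hy))
  have hE2 : ∀ x, ¬ Ex Δ x → ∀ y, Le Δ x y := by
    intro x hx y
    obtain ⟨r, hr⟩ := not_forall.1 hx
    by_contra hy
    exact hφ (Pr3.cases2 x y r (hmax' _ hr) (hmax' _ hy))
  have hsat := h (canon Δ) (by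
    rintro ⟨x, y⟩ hxy m hm
    exact (truth Δ hE y m).2 (Pr3.barbara ((truth Δ hE x m).1 hm) (Pr3.hyp (hΓ hxy))))
  obtain ⟨a, b⟩ := φ
  have ha : Ex Δ a := by
    by_contra ha
    exact hφ (hE2 a ha b)
  exact hφ ((truth Δ hE b (⟨a, ha⟩, true)).1 (hsat ((truth Δ hE a (⟨a, ha⟩, true)).2 (Pr3.ax a))))

end L3

/-- The L3 proof system is sound and complete: Γ ⊨ φ iff Γ ⊢ φ. -/
theorem stmt17 {P R : Type} (Γ : Set (Sent3 P R)) (φ : Sent3 P R) :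
    entails3 Γ φ ↔ Pr3 Γ φ := by
  exact ⟨L3.complete, L3.sound⟩
end

section
/- Let c₁ ∧ … ∧ c_k be an instance of 3-SAT and let Γ and φ be the associated L4 theory and sentence. Then Γ ⊭ φ if and only if c₁ ∧ … ∧ c_k is satisfiable. -/
/-- Terms of L4: nouns, (r all x), and complements x̄. -/
inductive Tm4 (P R : Type) : Type
  | noun : P → Tm4 P R
  | allT : R → Tm4 P R → Tm4 P R
  | comp : Tm4 P R → Tm4 P R

/-- Sentences of L4: (all x y). -/
inductive Sent4 (P R : Type) : Type
  | allS : Tm4 P R → Tm4 P R → Sent4 P R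

structure Model4 (P R : Type) where
  W : Type
  nounI : P → Set W
  verbI : R → W → W → Prop

def Tm4.interp {P R : Type} (M : Model4 P R) : Tm4 P R → Set M.W
  | .noun p => M.nounI p
  | .allT r x => {m | ∀ n ∈ Tm4.interp M x, M.verbI r m n}
  | .comp x => (Tm4.interp M x)ᶜ

def Model4.sat {P R : Type} (M : Model4 P R) : Sent4 P R → Prop
  | .allS x y => Tm4.interp M x ⊆ Tm4.interp M y

def entails4 {P R : Type} (Γ : Set (Sent4 P R)) (φ : Sent4 P R) : Prop :=
  ∀ M : Model4 P R, (∀ ψ ∈ Γ, M.sat ψ) → M.sat φ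

/-- Nouns of the encoding: a noun for each variable, the noun q, and nouns yᵢ, zᵢ
for each of the k clauses. -/
inductive N4 (V : Type) (k : ℕ) : Type
  | var : V → N4 V k
  | q : N4 V k
  | y : Fin k → N4 V k
  | z : Fin k → N4 V k

/-- A literal is a variable together with a sign (`true` = positive). -/
def Lit (V : Type) : Type := V × Bool

/-- The term corresponding to a literal: the noun p for P, its complement for ¬P. -/
def litTm {V : Type} {k : ℕ} : Lit V → Tm4 (N4 V k) (Fin k)
  | (p, true) => Tm4.noun (N4.var p)
  | (p, false) => Tm4.comp (Tm4.noun (N4.var p))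

/-- The truth of a literal under an assignment. -/
def litVal {V : Type} (f : V → Bool) : Lit V → Prop
  | (p, s) => f p = s

/-- The L4 theory Γ associated to the 3-SAT instance: for each clause
cᵢ = Uᵢ ∨ Vᵢ ∨ Wᵢ, the sentences (all ūᵢ (rᵢ all yᵢ)), (all v̄ᵢ (rᵢ all ȳᵢ)),
and (all (rᵢ all zᵢ) wᵢ). -/
def Gamma4 {V : Type} {k : ℕ} (cl : Fin k → Lit V × Lit V × Lit V) :
    Set (Sent4 (N4 V k) (Fin k)) :=
  {s | ∃ i : Fin k,
        s = Sent4.allS (Tm4.comp (litTm (cl i).1)) (Tm4.allT i (Tm4.noun (N4.y i))) ∨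
        s = Sent4.allS (Tm4.comp (litTm (cl i).2.1))
              (Tm4.allT i (Tm4.comp (Tm4.noun (N4.y i)))) ∨
        s = Sent4.allS (Tm4.allT i (Tm4.noun (N4.z i))) (litTm (cl i).2.2)}

theorem mem_litTm {V : Type} {k : ℕ} (M : Model4 (N4 V k) (Fin k)) (x : M.W) (f : V → Bool)
    (hf : ∀ p, f p = true ↔ x ∈ M.nounI (N4.var p)) (l : Lit V) :
    x ∈ Tm4.interp M (litTm l) ↔ litVal f l := by
  obtain ⟨p, s⟩ := l
  cases s
  · change ¬ (x ∈ M.nounI (N4.var p)) ↔ f p = false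
    rw [← hf p]; simp
  · exact (hf p).symm

/-- Γ ⊭ (all q q̄) iff the 3-SAT instance c₁ ∧ … ∧ c_k is satisfiable. -/
theorem stmt18 {V : Type} {k : ℕ} (cl : Fin k → Lit V × Lit V × Lit V) :
    ¬ entails4 (Gamma4 cl)
        (Sent4.allS (Tm4.noun N4.q) (Tm4.comp (Tm4.noun N4.q))) ↔
      ∃ f : V → Bool, ∀ i : Fin k,
        litVal f (cl i).1 ∨ litVal f (cl i).2.1 ∨ litVal f (cl i).2.2 := by
  classical
  constructor
  · intro h
    simp only [entails4, not_forall] at h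
    obtain ⟨M, hM, hq⟩ := h
    obtain ⟨x, -, -⟩ := Set.not_subset.mp hq
    have key := mem_litTm M x (fun p => decide (x ∈ M.nounI (N4.var p))) (by simp)
    refine ⟨fun p => decide (x ∈ M.nounI (N4.var p)), fun i => ?_⟩
    rw [← key, ← key, ← key]
    by_contra hc
    push Not at hc
    obtain ⟨hu, hv, hw⟩ := hc
    have h1 := hM _ ⟨i, Or.inl rfl⟩ hu
    have h2 := hM _ ⟨i, Or.inr (Or.inl rfl)⟩ hv
    refine hw (hM _ ⟨i, Or.inr (Or.inr rfl)⟩ ?_)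
    intro n _
    by_cases hn : n ∈ M.nounI (N4.y i)
    · exact h1 n hn
    · exact h2 n hn
  · rintro ⟨f, hf⟩ h
    let M : Model4 (N4 V k) (Fin k) :=
      { W := Unit
        nounI := fun n => match n with
          | .var p => {_x | f p = true}
          | .q => Set.univ
          | .y i => {_x | litVal f (cl i).1}
          | .z _ => Set.univ
        verbI := fun i _ _ => litVal f (cl i).2.2 }
    have key := fun x => mem_litTm M x f (fun p => Iff.rfl)
    refine h M ?_ (Set.mem_univ ()) (Set.mem_univ ())
    rintro ψ ⟨i, rfl | rfl | rfl⟩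
    · intro x hx n hn
      exact absurd ((key x _).2 hn) hx
    · intro x hx n hn
      rcases hf i with hu | hv | hw
      · exact absurd hu hn
      · exact absurd ((key x _).2 hv) hx
      · exact hw
    · intro x hx
      exact (key x _).2 (hx () (Set.mem_univ ()))
end
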